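/- arXiv:2002.06265 — 4 statements merged into one kernel-verified Lean document; each statement's English description precedes it below -/
import Mathlib

section
/- Let S be a string over an alphabet Σ with z LZ77-factors, and let q be a natural number such that S does not contain q-th powers. Then the number of right extensions of maximal repeats of S is at most 18·q·(1 + log_q|S|)·(z+2)² − (z+1). -/
variable {α : Type*}

/-- Character at 1-based position `i` of `S`; the sentinel `dollar` outside `[1, |S|]`,
in particular `S[0] = $` and `S[|S|+1] = $`. -/
def chr (dollar : α) (S : List α) (i : ℕ) : α :=
  if h : 1 ≤ i ∧ i ≤ S.length then S.get ⟨i - 1, by omega⟩ else dollar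

/-- The substring `S[i..j]` (as a list), using the sentinel convention. -/
def substr (dollar : α) (S : List α) (i j : ℕ) : List α :=
  (List.range (j + 1 - i)).map (fun k => chr dollar S (i + k))

/-- `Δ` is a period of `T`: `Δ ≥ 1` and characters at distance `Δ` coincide. -/
def IsPeriodOf (Δ : ℕ) (T : List α) : Prop :=
  1 ≤ Δ ∧ ∀ (k : ℕ) (h : k + Δ < T.length), T.get ⟨k, by omega⟩ = T.get ⟨k + Δ, h⟩

/-- The minimal period length of `T`. -/
noncomputable def minPeriod (T : List α) : ℕ := sInf {Δ | IsPeriodOf Δ T}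

/-- `T` is a fractional power with exponent ≥ `q`: its minimal period `Δ` satisfies `|T| ≥ q·Δ`. -/
def IsFracPowGe (q : ℕ) (T : List α) : Prop := q * minPeriod T ≤ T.length

/-- `(n, m, l)` is a maximal pair of `S` (`l ≥ 1`, both occurrences inside `S`,
equal as strings, different preceding characters, different succeeding characters). -/
def IsMaximalPair (dollar : α) (S : List α) (n m l : ℕ) : Prop :=
  1 ≤ l ∧ 1 ≤ n ∧ 1 ≤ m ∧ n + l - 1 ≤ S.length ∧ m + l - 1 ≤ S.length ∧
  (∀ k < l, chr dollar S (n + k) = chr dollar S (m + k)) ∧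
  chr dollar S (n - 1) ≠ chr dollar S (m - 1) ∧
  chr dollar S (n + l) ≠ chr dollar S (m + l)

/-- The two maximal pairs `p`, `p'` of `S` are copies of each other: the unordered pairs of
padded occurrence strings `{S[n-1..n+l], S[m-1..m+l]}` coincide. -/
def CopiesMP (dollar : α) (S : List α) (p p' : ℕ × ℕ × ℕ) : Prop :=
  ({substr dollar S (p.1 - 1) (p.1 + p.2.2), substr dollar S (p.2.1 - 1) (p.2.1 + p.2.2)} :
      Set (List α)) =
  ({substr dollar S (p'.1 - 1) (p'.1 + p'.2.2), substr dollar S (p'.2.1 - 1) (p'.2.1 + p'.2.2)} :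
      Set (List α))

/-- `P` occurs at least twice in `T` (occurrences may overlap). -/
def OccursTwiceIn (P T : List α) : Prop :=
  ∃ p₁ p₂ : ℕ, p₁ < p₂ ∧ p₂ + P.length ≤ T.length ∧ P <+: T.drop p₁ ∧ P <+: T.drop p₂

/-- `L` is the (self-referential) LZ77-decomposition of `S`: each factor is either a fresh
single character, or the longest prefix of the remaining suffix occurring at least twice in
the text up to (and including) this factor. -/
def IsLZ77 (S : List α) (L : List (List α)) : Prop :=
  S = L.flatten ∧
  ∀ (i : ℕ) (h : i < L.length),
    L.get ⟨i, h⟩ ≠ [] ∧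
    ((∃ c : α, L.get ⟨i, h⟩ = [c] ∧ c ∉ (L.take i).flatten) ∨
     (OccursTwiceIn (L.get ⟨i, h⟩) ((L.take i).flatten ++ L.get ⟨i, h⟩) ∧
      ∀ F' : List α, F' <+: S.drop ((L.take i).flatten).length →
        OccursTwiceIn F' ((L.take i).flatten ++ F') → F'.length ≤ (L.get ⟨i, h⟩).length))

/-- The cyclic rotation of `S$` by `k`. -/
def rot (dollar : α) (S : List α) (k : ℕ) : List α :=
  (S ++ [dollar]).drop k ++ (S ++ [dollar]).take k

/-- `π` enumerates (1-based, for `i = 1, …, |S|+1`) the cyclic rotations of `S$`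
in lexicographic order; the BWT of `S` is then `i ↦ S[π i]`. -/
def IsBWTPerm [LinearOrder α] (dollar : α) (S : List α) (π : ℕ → ℕ) : Prop :=
  (∀ i, 1 ≤ i → i ≤ S.length + 1 → π i ≤ S.length) ∧
  (∀ i j, 1 ≤ i → i < j → j ≤ S.length + 1 →
    List.Lex (· < ·) (rot dollar S (π i)) (rot dollar S (π j)))

/-- Number of occurrences of `P` in `T`. -/
def occCount [DecidableEq α] (P T : List α) : ℕ :=
  ((Finset.range (T.length + 1)).filter
    (fun p => p + P.length ≤ T.length ∧ P <+: T.drop p)).card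

/-- `P` is a maximal repeat of `S`: nonempty, occurs at least twice, and every one-character
extension occurs strictly fewer times. -/
def IsMaximalRepeat [DecidableEq α] (S P : List α) : Prop :=
  P ≠ [] ∧ 2 ≤ occCount P S ∧
  (∀ c : α, occCount (c :: P) S < occCount P S) ∧
  (∀ c : α, occCount (P ++ [c]) S < occCount P S)

/-- `u` is primitive: not expressible as `v^k` with `k ≥ 2`. -/
def Primitive (u : List α) : Prop :=
  ∀ (v : List α) (k : ℕ), 2 ≤ k → u ≠ (List.replicate k v).flatten

/-- `(l', r')` is the maximal `Δ`-periodic extension of the occurrence `S[l..r]`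
(the padded maximal `Δ`-periodic extension is then `(l'-1, r'+1)`). -/
def IsMaxPerExt (dollar : α) (S : List α) (Δ l r l' r' : ℕ) : Prop :=
  1 ≤ l' ∧ l' ≤ l ∧ l ≤ r ∧ r ≤ r' ∧ r' ≤ S.length ∧ Δ ≤ r + 1 - l ∧
  IsPeriodOf Δ (substr dollar S l' r') ∧
  ¬ IsPeriodOf Δ (substr dollar S (l' - 1) r') ∧
  ¬ IsPeriodOf Δ (substr dollar S l' (r' + 1))

/-- The maximal periodic extension (w.r.t. the minimal period length) of the occurrence
`S[l..r]` adds at most one period length of additional characters. -/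
def ShortExt (dollar : α) (S : List α) (l r : ℕ) : Prop :=
  ∃ l' r', IsMaxPerExt dollar S (minPeriod (substr dollar S l r)) l r l' r' ∧
    (l - l') + (r' - r) ≤ minPeriod (substr dollar S l r)

/-- `h` has period `p` on the positions `1, …, m`. -/
def PeriodicTo (h : ℕ → α) (p m : ℕ) : Prop := ∀ k, 1 ≤ k → k + p ≤ m → h k = h (k + p)

/-- The properties of the set `O` of overlap lengths between a fixed left context and the
word `h 1, h 2, …`, in the absence of `q`-th powers. -/
structure IsOverlapSet (h : ℕ → α) (q : ℕ) (O : Finset ℕ) : Prop where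
  one_le : ∀ s ∈ O, 1 ≤ s
  periodic : ∀ s ∈ O, ∀ t ∈ O, s < t → PeriodicTo h (t - s) t
  sub_mem : ∀ t ∈ O, ∀ p, 0 < p → p < t → PeriodicTo h p t → t - p ∈ O
  lt_mul : ∀ s ∈ O, ∀ p, 0 < p → PeriodicTo h p s → s < q * p

theorem PeriodicTo.mono {h : ℕ → α} {p m m' : ℕ} (H : PeriodicTo h p m) (hm : m' ≤ m) :
    PeriodicTo h p m' := fun k hk hkm => H k hk (hkm.trans hm)

/-- Gaps between consecutive overlap lengths are nondecreasing. -/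
theorem IsOverlapSet.gap_mono {h : ℕ → α} {q : ℕ} {O : Finset ℕ} (H : IsOverlapSet h q O)
    {s t r : ℕ} (hs : s ∈ O) (ht : t ∈ O) (hr : r ∈ O) (hst : s < t) (htr : t < r)
    (hst' : ∀ x ∈ O, ¬ (s < x ∧ x < t)) : t - s ≤ r - t := by
  by_contra! hlt
  have hp := (H.periodic t ht r hr htr).mono htr.le
  have := H.sub_mem t ht (r - t) (by omega) (by omega) hp
  exact hst' _ this (by have := H.one_le s hs; omega)

/-- When the gap changes, the new gap exceeds the smallest of the three overlap lengths. -/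
theorem IsOverlapSet.lt_gap {h : ℕ → α} {q : ℕ} {O : Finset ℕ} (H : IsOverlapSet h q O)
    {s t r : ℕ} (hs : s ∈ O) (ht : t ∈ O) (hr : r ∈ O) (hst : s < t) (htr : t < r)
    (htr' : ∀ x ∈ O, ¬ (t < x ∧ x < r)) (hgap : t - s < r - t) : s < r - t := by
  by_contra! hle
  have hg := H.periodic s hs t ht hst
  have hg' := H.periodic t ht r hr htr
  have hp : PeriodicTo h (t - s) r := by
    intro k hk hkr
    by_cases hkt : k + (t - s) ≤ t
    · exact hg k hk hkt
    · have e1 := hg' (k - (r - t)) (by omega) (by omega)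
      have e2 := hg' (k - (r - t) + (t - s)) (by omega) (by omega)
      have e3 := hg (k - (r - t)) (by omega) (by omega)
      rw [show k - (r - t) + (r - t) = k by omega] at e1
      rw [show k - (r - t) + (t - s) + (r - t) = k + (t - s) by omega] at e2
      rw [← e1, e3, e2]
  have := H.sub_mem r hr (t - s) (by omega) (by omega) hp
  exact htr' _ this (by omega)

/-- Along `2 * q` consecutive overlap lengths, the length grows by a factor `q`. -/
theorem IsOverlapSet.mul_le_add {h : ℕ → α} {q : ℕ} {O : Finset ℕ} (H : IsOverlapSet h q O)
    (hq : 1 ≤ q) {a : ℕ → ℕ} {N : ℕ} (hmem : ∀ k < N, a k ∈ O)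
    (hlt : ∀ k, k + 1 < N → a k < a (k + 1))
    (hcons : ∀ k, k + 1 < N → ∀ x ∈ O, ¬ (a k < x ∧ x < a (k + 1)))
    (k₀ : ℕ) (hk₀ : k₀ + 2 * q < N) : q * a k₀ ≤ a (k₀ + 2 * q) := by
  have hmono : ∀ j i, i + j < N → a i ≤ a (i + j) := by
    intro j
    induction j with
    | zero => simp
    | succ j ih =>
      intro i hi
      exact (ih i (by omega)).trans (hlt (i + j) (by omega)).le
  obtain ⟨k, hk1, hk2, hk3⟩ : ∃ k, k₀ ≤ k ∧ k + 2 ≤ k₀ + q ∧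
      a (k + 1) - a k ≠ a (k + 2) - a (k + 1) := by
    by_contra! hcon
    have hgap : ∀ j, j < q → a (k₀ + j + 1) - a (k₀ + j) = a (k₀ + 1) - a k₀ := by
      intro j
      induction j with
      | zero => simp
      | succ j ih =>
        intro hj
        rw [← ih (by omega)]
        exact (hcon (k₀ + j) (by omega) (by omega)).symm
    have hsum : ∀ j, j ≤ q → a (k₀ + j) = a k₀ + j * (a (k₀ + 1) - a k₀) := by
      intro j
      induction j with
      | zero => simp
      | succ j ih =>
        intro hj
        have h1 := ih (by omega)
        have h2 := hgap j (by omega)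
        have h3 := hlt (k₀ + j) (by omega)
        rw [show k₀ + (j + 1) = k₀ + j + 1 by omega, Nat.succ_mul]
        omega
    obtain ⟨m, rfl⟩ : ∃ m, q = m + 1 := ⟨q - 1, by omega⟩
    have h1 := hsum (m + 1) le_rfl
    have h2 := hgap m (by omega)
    have h3 := hlt (k₀ + m) (by omega)
    have h4 := H.lt_mul (a (k₀ + m + 1)) (hmem _ (by omega)) _ (Nat.sub_pos_of_lt h3)
      (H.periodic _ (hmem _ (by omega)) _ (hmem _ (by omega)) h3)
    rw [h2] at h4
    rw [show k₀ + (m + 1) = k₀ + m + 1 by omega] at h1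
    omega
  have hge := H.gap_mono (hmem k (by omega)) (hmem (k + 1) (by omega)) (hmem (k + 2) (by omega))
    (hlt k (by omega)) (hlt (k + 1) (by omega)) (hcons k (by omega))
  have hbig := H.lt_gap (hmem k (by omega)) (hmem (k + 1) (by omega)) (hmem (k + 2) (by omega))
    (hlt k (by omega)) (hlt (k + 1) (by omega)) (hcons (k + 1) (by omega))
    (lt_of_le_of_ne hge hk3)
  have hgaps : ∀ j, k + j + 2 < N → a k ≤ a (k + j + 2) - a (k + j + 1) := by
    intro j
    induction j with
    | zero => intro _; exact hbig.le
    | succ j ih =>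
      intro hj
      exact (ih (by omega)).trans
        (H.gap_mono (hmem (k + j + 1) (by omega)) (hmem (k + j + 2) (by omega))
          (hmem (k + j + 3) (by omega)) (hlt (k + j + 1) (by omega)) (hlt (k + j + 2) (by omega))
          (hcons (k + j + 1) (by omega)))
  have hsum : ∀ j, k + j + 1 < N → j * a k ≤ a (k + j + 1) := by
    intro j
    induction j with
    | zero => simp
    | succ j ih =>
      intro hj
      have h1 := ih (by omega)
      have h2 := hgaps j (by omega)
      have h3 := hlt (k + j + 1) (by omega)
      rw [Nat.succ_mul, show k + (j + 1) + 1 = k + j + 2 by omega]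
      rw [show k + j + 1 + 1 = k + j + 2 by omega] at h3
      omega
  have hle : a k₀ ≤ a k := by
    have := hmono (k - k₀) k₀ (by omega)
    rwa [show k₀ + (k - k₀) = k by omega] at this
  have hle' : a (k + q + 1) ≤ a (k₀ + 2 * q) := by
    have := hmono (k₀ + 2 * q - (k + q + 1)) (k + q + 1) (by omega)
    rwa [show k + q + 1 + (k₀ + 2 * q - (k + q + 1)) = k₀ + 2 * q by omega] at this
  exact ((Nat.mul_le_mul_left q hle).trans (hsum q (by omega))).trans hle'

theorem IsOverlapSet.card_le {h : ℕ → α} {q : ℕ} {O : Finset ℕ} (H : IsOverlapSet h q O)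
    (hq : 2 ≤ q) {n : ℕ} (hn : ∀ s ∈ O, s ≤ n) :
    O.card ≤ 2 * q * (1 + Nat.log q n) := by
  have hf : (Set.ofPred (· ∈ O)).Finite := O.finite_toSet
  have hcard : hf.toFinset.card = O.card := by congr 1; ext; simp
  set a := Nat.nth (· ∈ O) with ha
  have hmem : ∀ k < O.card, a k ∈ O := fun k hk =>
    Nat.nth_mem_of_lt_card (p := (· ∈ O)) hf (hcard ▸ hk)
  have hlt : ∀ k, k + 1 < O.card → a k < a (k + 1) := fun k hk =>
    Nat.nth_lt_nth_of_lt_card (p := (· ∈ O)) hf (Nat.lt_succ_self k) (hcard ▸ hk)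
  have hcons : ∀ k, k + 1 < O.card → ∀ x ∈ O, ¬ (a k < x ∧ x < a (k + 1)) := by
    rintro k hk x hx ⟨h1, h2⟩
    obtain ⟨m, hm, rfl⟩ := Nat.exists_lt_card_finite_nth_eq (p := (· ∈ O)) hf hx
    have h3 := Nat.lt_of_nth_lt_nth_of_lt_card (p := (· ∈ O)) hf h1
      (by rw [hcard]; omega)
    have h4 := Nat.lt_of_nth_lt_nth_of_lt_card (p := (· ∈ O)) hf h2 hm
    omega
  have hpow : ∀ j, j * (2 * q) < O.card → q ^ j ≤ a (j * (2 * q)) := by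
    intro j
    induction j with
    | zero =>
      intro h0
      simpa using H.one_le _ (hmem 0 (by omega))
    | succ j ih =>
      intro hj
      rw [Nat.succ_mul] at hj
      rw [Nat.succ_mul, pow_succ, mul_comm]
      exact (Nat.mul_le_mul_left q (ih (by omega))).trans
        (H.mul_le_add (by omega) hmem hlt hcons _ hj)
  by_contra! hlarge
  have h1 : (1 + Nat.log q n) * (2 * q) < O.card := by rwa [mul_comm]
  have h2 := (hpow _ h1).trans (hn _ (hmem _ h1))
  have h3 := Nat.lt_pow_succ_log_self (b := q) (by omega) n
  rw [add_comm] at h2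
  exact absurd h2 (not_le.mpr h3)

theorem chr_succ (dollar : α) (S : List α) {i : ℕ} (hi : i < S.length) :
    chr dollar S (i + 1) = S[i] := by
  simp [chr, Nat.succ_le_of_lt hi]

theorem chr_eq_dollar_iff {dollar : α} {S : List α} (hdollar : dollar ∉ S) {i : ℕ} :
    chr dollar S i = dollar ↔ i = 0 ∨ S.length < i := by
  unfold chr
  split_ifs with h
  · constructor
    · intro he
      exact absurd (he ▸ List.get_mem S _) hdollar
    · omega
  · simp only [true_iff]
    omega

theorem prefix_drop_iff (dollar : α) {S P : List α} {p : ℕ} (hp : p + P.length ≤ S.length) :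
    P <+: S.drop p ↔ ∀ k (hk : k < P.length), P[k] = chr dollar S (p + k + 1) := by
  rw [List.prefix_iff_getElem]
  constructor
  · rintro ⟨h1, h2⟩ k hk
    rw [h2 k hk, chr_succ dollar S (by omega), List.getElem_drop]
  · intro h
    refine ⟨by rw [List.length_drop]; omega, fun k hk => ?_⟩
    rw [h k hk, chr_succ dollar S (by omega), List.getElem_drop]

/-- A period `p` of `S` on the window of length `s ≥ q * p` after position `v` yields a
`q`-th power. -/
theorem lt_mul_of_periodicTo (dollar : α) {S : List α} {q : ℕ}
    (hq : ∀ w : List α, w ≠ [] → ¬ ((List.replicate q w).flatten <:+: S))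
    {v s p : ℕ} (hs : v + s ≤ S.length) (hp : 0 < p)
    (hper : PeriodicTo (fun k => chr dollar S (v + k)) p s) : s < q * p := by
  by_contra! hle
  have hstep : ∀ k, k + p < s → S[v + k]? = S[v + (k + p)]? := by
    intro k hk
    have h := hper (k + 1) (by omega) (by omega)
    simp only at h
    rw [show v + (k + 1) = v + k + 1 by omega,
      show v + (k + 1 + p) = v + (k + p) + 1 by omega,
      chr_succ dollar S (by omega), chr_succ dollar S (by omega)] at h
    rw [List.getElem?_eq_getElem (by omega), List.getElem?_eq_getElem (by omega), h]
  have hmul : ∀ m k, k < p → m * p + k < s → S[v + (m * p + k)]? = S[v + k]? := by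
    intro m
    induction m with
    | zero => simp
    | succ m ih =>
      intro k hk hkm
      rw [Nat.succ_mul] at hkm ⊢
      rw [← ih k hk (by omega), hstep (m * p + k) (by omega)]
      congr 2
      omega
  have hpow : ∀ m, m * p ≤ s →
      (S.drop v).take (m * p) = (List.replicate m ((S.drop v).take p)).flatten := by
    intro m
    induction m with
    | zero => simp
    | succ m ih =>
      intro hm
      rw [Nat.succ_mul] at hm
      rw [Nat.succ_mul, List.take_add, ih (by omega), List.replicate_succ', List.flatten_append]
      congr 1
      simp only [List.flatten_cons, List.flatten_nil, List.append_nil]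
      apply List.ext_getElem?
      intro k
      by_cases hk : k < p
      · rw [List.getElem?_take_of_lt hk, List.getElem?_take_of_lt hk, List.getElem?_drop,
          List.getElem?_drop, List.getElem?_drop]
        exact hmul m k hk (by omega)
      · rw [List.getElem?_eq_none (by rw [List.length_take]; omega),
          List.getElem?_eq_none (by rw [List.length_take]; omega)]
  refine hq ((S.drop v).take p) ?_ ?_
  · intro h
    have := congrArg List.length h
    have : p ≤ q * p := by
      rcases Nat.eq_zero_or_pos q with rfl | h0
      · exact absurd (by simp) (hq [dollar] (by simp))
      · exact Nat.le_mul_of_pos_left p h0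
    simp only [List.length_take, List.length_drop, List.length_nil] at *
    omega
  · rw [← hpow q hle]
    exact (List.take_prefix _ _).isInfix.trans (List.drop_suffix _ _).isInfix

/-- The lengths `s ≥ 1` such that the `s` characters before the cut `u` agree with the `s`
characters after the cut `v`. -/
noncomputable def overlaps (dollar : α) (S : List α) (u v : ℕ) : Finset ℕ :=
  open Classical in
  (Finset.Icc 1 S.length).filter fun s => s ≤ u ∧ v + s ≤ S.length ∧
    ∀ k, 1 ≤ k → k ≤ s → chr dollar S (u - s + k) = chr dollar S (v + k)

theorem mem_overlaps {dollar : α} {S : List α} {u v s : ℕ} :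
    s ∈ overlaps dollar S u v ↔ 1 ≤ s ∧ s ≤ u ∧ v + s ≤ S.length ∧
      ∀ k, 1 ≤ k → k ≤ s → chr dollar S (u - s + k) = chr dollar S (v + k) := by
  simp only [overlaps, Finset.mem_filter, Finset.mem_Icc]
  constructor
  · rintro ⟨⟨h1, _⟩, h⟩
    exact ⟨h1, h⟩
  · rintro ⟨h1, h2, h3, h⟩
    exact ⟨⟨h1, by omega⟩, h2, h3, h⟩

theorem isOverlapSet_overlaps (dollar : α) {S : List α} {q : ℕ}
    (hq : ∀ w : List α, w ≠ [] → ¬ ((List.replicate q w).flatten <:+: S)) (u v : ℕ) :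
    IsOverlapSet (fun k => chr dollar S (v + k)) q (overlaps dollar S u v) where
  one_le s hs := (mem_overlaps.1 hs).1
  periodic s hs t ht hst k hk hkt := by
    obtain ⟨_, _, _, h⟩ := mem_overlaps.1 hs
    obtain ⟨_, _, _, h'⟩ := mem_overlaps.1 ht
    simp only
    rw [← h k hk (by omega), ← h' (k + (t - s)) (by omega) hkt]
    congr 1
    omega
  sub_mem t ht p hp hpt hper := by
    obtain ⟨_, _, _, h⟩ := mem_overlaps.1 ht
    refine mem_overlaps.2 ⟨by omega, by omega, by omega, fun k hk hkt => ?_⟩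
    have h1 := h (k + p) (by omega) (by omega)
    have h2 := hper k hk (by omega)
    simp only at h2
    rw [h2, ← h1]
    congr 1
    omega
  lt_mul s hs p hp hper := lt_mul_of_periodicTo dollar hq (mem_overlaps.1 hs).2.2.1 hp hper

theorem card_overlaps_le (dollar : α) {S : List α} {q : ℕ} (hq2 : 2 ≤ q)
    (hq : ∀ w : List α, w ≠ [] → ¬ ((List.replicate q w).flatten <:+: S)) (u v : ℕ) :
    (overlaps dollar S u v).card ≤ 2 * q * (1 + Nat.log q S.length) :=
  (isOverlapSet_overlaps dollar hq u v).card_le hq2 fun s hs => by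
    have := (mem_overlaps.1 hs).2.2.1
    omega

/-- The end positions of the prefixes of the factorization `L`. -/
def cuts (L : List (List α)) : Finset ℕ :=
  (Finset.range (L.length + 1)).image fun i => (L.take i).flatten.length

theorem card_cuts_le (L : List (List α)) : (cuts L).card ≤ L.length + 1 :=
  Finset.card_image_le.trans (by simp)

/-- Every character of a copied LZ77-factor equals the one at a fixed positive distance
`δ` before it. -/
theorem IsLZ77.exists_shift (dollar : α) {S : List α} {L : List (List α)} (hL : IsLZ77 S L)
    {i : ℕ} (hi : i < L.length)
    (hlen : (L.take i).flatten.length + 2 ≤ (L.take (i + 1)).flatten.length) :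
    ∃ δ, 0 < δ ∧ δ ≤ (L.take i).flatten.length ∧
      ∀ t, (L.take i).flatten.length < t → t ≤ (L.take (i + 1)).flatten.length →
        chr dollar S (t - δ) = chr dollar S t := by
  obtain ⟨hS, hfac⟩ := hL
  obtain ⟨-, hF⟩ := hfac i hi
  simp only [List.get_eq_getElem] at hF
  have htake : (L.take (i + 1)).flatten = (L.take i).flatten ++ L[i] := by
    rw [List.take_succ_eq_append_getElem hi, List.flatten_append]
    simp
  have hpre : (L.take i).flatten ++ L[i] <+: S := by
    rw [← htake, hS]
    conv_rhs => rw [← List.take_append_drop (i + 1) L, List.flatten_append]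
    exact List.prefix_append _ _
  rw [htake] at hlen ⊢
  set U := (L.take i).flatten
  set F := L[i]
  rw [List.length_append] at hlen ⊢
  rcases hF with ⟨c, hc, -⟩ | ⟨⟨p₁, p₂, hlt, hle, hp₁, hp₂⟩, -⟩
  · rw [hc] at hlen
    simp at hlen
  rw [List.length_append] at hle
  have hSlen := hpre.length_le
  rw [List.length_append] at hSlen
  obtain ⟨V, hV⟩ := hpre
  have hF1 : F <+: S.drop p₁ := by
    rw [← hV, List.drop_append_of_le_length (by rw [List.length_append]; omega)]
    exact hp₁.trans (List.prefix_append _ _)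
  have hF2 : F <+: S.drop U.length := by
    rw [← hV, List.append_assoc, List.drop_left]
    exact List.prefix_append _ _
  rw [prefix_drop_iff dollar (by omega)] at hF1 hF2
  refine ⟨U.length - p₁, by omega, by omega, fun t ht1 ht2 => ?_⟩
  have h1 := hF1 (t - U.length - 1) (by omega)
  have h2 := hF2 (t - U.length - 1) (by omega)
  rw [h2] at h1
  rw [show t - (U.length - p₁) = p₁ + (t - U.length - 1) + 1 by omega, ← h1]
  congr 1
  omega

/-- Every padded substring `S[a..a+l+1]` with `1 ≤ l` has a copy whose inner part touches a
factor boundary. -/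
theorem IsLZ77.exists_copy_at_cut (dollar : α) {S : List α} {L : List (List α)}
    (hL : IsLZ77 S L) {l : ℕ} (hl : 1 ≤ l) (a : ℕ) (ha : a + l ≤ S.length) :
    ∃ a', a' + l ≤ S.length ∧ (∀ k ≤ l + 1, chr dollar S (a' + k) = chr dollar S (a + k)) ∧
      ∃ u ∈ cuts L, a' ≤ u ∧ u ≤ a' + l := by
  induction a using Nat.strong_induction_on with
  | _ a ih =>
    by_cases hcut : ∃ u ∈ cuts L, a ≤ u ∧ u ≤ a + l
    · exact ⟨a, ha, fun _ _ => rfl, hcut⟩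
    have hno : ∀ i ≤ L.length, (L.take i).flatten.length < a ∨
        a + l < (L.take i).flatten.length := by
      intro i hi
      by_contra! hcon
      exact hcut ⟨_, Finset.mem_image_of_mem _ (Finset.mem_range.2 (by omega)), hcon⟩
    obtain ⟨i, hi, hi1, hi2⟩ : ∃ i < L.length, (L.take i).flatten.length < a ∧
        a + l < (L.take (i + 1)).flatten.length := by
      by_contra! hcon
      have hall : ∀ i ≤ L.length, (L.take i).flatten.length < a := by
        intro i
        induction i with
        | zero =>
          intro _
          have := hno 0 (Nat.zero_le _)
          simp at this ⊢
          exact this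
        | succ i ihi =>
          intro hi
          have h1 := hcon i (by omega) (ihi (by omega))
          have h2 := hno (i + 1) hi
          omega
      have := hall L.length le_rfl
      rw [List.take_length, ← hL.1] at this
      omega
    obtain ⟨δ, hδ, hδi, hshift⟩ := hL.exists_shift dollar hi (by omega)
    obtain ⟨a', ha', heq, hu⟩ := ih (a - δ) (by omega) (by omega)
    refine ⟨a', ha', fun k hk => ?_, hu⟩
    rw [heq k hk, ← hshift (a + k) (by omega) (by omega)]
    congr 1
    omega

/-- `P` occurs in `S` right after position `a`. -/
def OccursAt (dollar : α) (S P : List α) (a : ℕ) : Prop :=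
  a + P.length ≤ S.length ∧ ∀ k (hk : k < P.length), P[k] = chr dollar S (a + k + 1)

open Classical in
theorem occCount_eq_card [DecidableEq α] (dollar : α) (S P : List α) :
    occCount P S =
      ((Finset.range (S.length + 1)).filter fun a => OccursAt dollar S P a).card := by
  unfold occCount
  congr 1
  ext a
  simp only [Finset.mem_filter, and_congr_right_iff]
  intro _
  unfold OccursAt
  constructor
  · rintro ⟨h1, h2⟩
    exact ⟨h1, (prefix_drop_iff dollar h1).1 h2⟩
  · rintro ⟨h1, h2⟩
    exact ⟨h1, (prefix_drop_iff dollar h1).2 h2⟩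

theorem occCount_le_one [DecidableEq α] (dollar : α) {S P : List α} {x : ℕ}
    (h : ∀ a, OccursAt dollar S P a → a = x) : occCount P S ≤ 1 := by
  classical
  rw [occCount_eq_card dollar, Finset.card_le_one]
  intro a ha b hb
  rw [h a (Finset.mem_filter.1 ha).2, h b (Finset.mem_filter.1 hb).2]

/-- Not all occurrences of a maximal repeat are preceded by the same character. -/
theorem IsMaximalRepeat.exists_left_ne [DecidableEq α] {dollar : α} {S P : List α}
    (hdollar : dollar ∉ S) (hP : IsMaximalRepeat S P) (x : α) :
    ∃ a, OccursAt dollar S P a ∧ chr dollar S a ≠ x := by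
  classical
  by_contra! hcon
  obtain ⟨-, h2, hleft, -⟩ := hP
  by_cases hx : x = dollar
  · subst hx
    have : occCount P S ≤ 1 := occCount_le_one x (x := 0) fun a ha => by
      have h1 := (chr_eq_dollar_iff hdollar).1 (hcon a ha)
      have h2 := ha.1
      omega
    omega
  · refine absurd (hleft x) (not_lt.2 ?_)
    have hpos : ∀ a, OccursAt dollar S P a → 0 < a := by
      intro a ha
      by_contra! h0
      refine hx ((hcon a ha).symm.trans ((chr_eq_dollar_iff hdollar).2 (Or.inl (by omega))))
    rw [occCount_eq_card dollar, occCount_eq_card dollar]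
    refine Finset.card_le_card_of_injOn (fun a => a - 1) ?_ ?_
    · intro a ha
      simp only [Finset.coe_filter, Finset.mem_range, Set.mem_ofPred_eq] at ha ⊢
      have h0 := hpos a ha.2
      refine ⟨by omega, ?_, ?_⟩
      · have := ha.2.1
        rw [List.length_cons]
        omega
      · rintro (_ | k) hk
        · rw [List.getElem_cons_zero, ← hcon a ha.2]
          congr 1
          omega
        · rw [List.getElem_cons_succ, ha.2.2]
          congr 1
          omega
    · intro a ha b hb hab
      simp only [Finset.coe_filter, Finset.mem_range, Set.mem_ofPred_eq] at ha hb hab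
      have h1 := hpos a ha.2
      have h2 := hpos b hb.2
      omega

/-- Not all occurrences of a maximal repeat are followed by the same character. -/
theorem IsMaximalRepeat.exists_right_ne [DecidableEq α] {dollar : α} {S P : List α}
    (hdollar : dollar ∉ S) (hP : IsMaximalRepeat S P) (x : α) :
    ∃ a, OccursAt dollar S P a ∧ chr dollar S (a + P.length + 1) ≠ x := by
  classical
  by_contra! hcon
  obtain ⟨-, h2, -, hright⟩ := hP
  by_cases hx : x = dollar
  · subst hx
    have : occCount P S ≤ 1 := occCount_le_one x (x := S.length - P.length) fun a ha => by
      have h1 := (chr_eq_dollar_iff hdollar).1 (hcon a ha)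
      have h2 := ha.1
      omega
    omega
  · refine absurd (hright x) (not_lt.2 ?_)
    rw [occCount_eq_card dollar, occCount_eq_card dollar]
    refine Finset.card_le_card fun a ha => ?_
    simp only [Finset.mem_filter] at ha ⊢
    have hlt : a + P.length < S.length := by
      by_contra! h0
      exact hx ((hcon a ha.2).symm.trans ((chr_eq_dollar_iff hdollar).2 (Or.inr (by omega))))
    refine ⟨ha.1, by rw [List.length_append, List.length_singleton]; omega, fun k hk => ?_⟩
    rw [List.length_append, List.length_singleton] at hk
    by_cases hk' : k < P.length
    · rw [List.getElem_append_left hk', ha.2.2 k hk']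
    · obtain rfl : k = P.length := by omega
      rw [List.getElem_concat_length rfl, hcon a ha.2]

theorem exists_occursAt_of_infix (dollar : α) {S P : List α} {c : α}
    (h : (P ++ [c]) <:+: (S ++ [dollar])) :
    ∃ a, OccursAt dollar S P a ∧ chr dollar S (a + P.length + 1) = c := by
  obtain ⟨U, V, hUV⟩ := h
  have hlen := congrArg List.length hUV
  simp only [List.length_append, List.length_singleton] at hlen
  have hget : ∀ i, i ≤ S.length → (S ++ [dollar])[i]? = some (chr dollar S (i + 1)) := by
    intro i hi
    rcases hi.lt_or_eq with hi | rfl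
    · rw [List.getElem?_append_left hi, chr_succ dollar S hi, List.getElem?_eq_getElem hi]
    · simp [chr]
  have hget' : ∀ k (hk : k < P.length + 1),
      (P ++ [c])[k]'(by simpa using hk) = chr dollar S (U.length + k + 1) := by
    intro k hk
    have h1 := hget (U.length + k) (by omega)
    rw [← hUV, List.getElem?_append_left (by simp; omega),
      List.getElem?_append_right (by omega), Nat.add_sub_cancel_left,
      List.getElem?_eq_getElem (by simpa using hk)] at h1
    exact Option.some.inj h1
  refine ⟨U.length, ⟨by omega, fun k hk => ?_⟩, ?_⟩
  · rw [← hget' k (by omega), List.getElem_append_left hk]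
  · rw [← hget' P.length (by omega), List.getElem_concat_length rfl]

/-- Every right extension of a maximal repeat stems from a maximal pair. -/
theorem IsMaximalRepeat.exists_pair [DecidableEq α] {dollar : α} {S P : List α} {c : α}
    (hdollar : dollar ∉ S) (hP : IsMaximalRepeat S P)
    (hc : (P ++ [c]) <:+: (S ++ [dollar])) :
    ∃ a b, OccursAt dollar S P a ∧ OccursAt dollar S P b ∧
      chr dollar S (a + P.length + 1) = c ∧ chr dollar S (b + P.length + 1) ≠ c ∧
      chr dollar S a ≠ chr dollar S b := by
  obtain ⟨p, hp, hpc⟩ := exists_occursAt_of_infix dollar hc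
  obtain ⟨r, hr, hrc⟩ := hP.exists_right_ne hdollar c
  by_cases h1 : chr dollar S p = chr dollar S r
  · obtain ⟨t, ht, htx⟩ := hP.exists_left_ne hdollar (chr dollar S p)
    by_cases h2 : chr dollar S (t + P.length + 1) = c
    · exact ⟨t, r, ht, hr, h2, hrc, h1 ▸ htx⟩
    · exact ⟨p, t, hp, ht, hpc, h2, htx.symm⟩
  · exact ⟨p, r, hp, hr, hpc, hrc, h1⟩

/-- `P` occurs after `a` touching the cut `u` and after `b` touching the cut `v`; the two
occurrences cannot be extended simultaneously, and the offsets of the cuts differ by `s`. -/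
structure IsAnchoredPair (dollar : α) (S P : List α) (u v s a b : ℕ) : Prop where
  left : OccursAt dollar S P a
  right : OccursAt dollar S P b
  prev_ne : chr dollar S a ≠ chr dollar S b
  next_ne : chr dollar S (a + P.length + 1) ≠ chr dollar S (b + P.length + 1)
  le_u : a ≤ u
  u_le : u ≤ a + P.length
  le_v : b ≤ v
  v_le : v ≤ b + P.length
  offset : u - a = v - b + s

theorem IsAnchoredPair.chr_eq {dollar : α} {S P : List α} {u v s a b : ℕ}
    (h : IsAnchoredPair dollar S P u v s a b) {k : ℕ} (hk : 1 ≤ k) (hkl : k ≤ P.length) :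
    chr dollar S (a + k) = chr dollar S (b + k) := by
  have h1 := h.left.2 (k - 1) (by omega)
  have h2 := h.right.2 (k - 1) (by omega)
  rw [show a + k = a + (k - 1) + 1 by omega, ← h1, h2]
  congr 1
  omega

theorem IsAnchoredPair.mem_overlaps {dollar : α} {S P : List α} {u v s a b : ℕ}
    (h : IsAnchoredPair dollar S P u v s a b) : s ∈ insert 0 (overlaps dollar S u v) := by
  rcases Nat.eq_zero_or_pos s with rfl | hs
  · exact Finset.mem_insert_self _ _
  · refine Finset.mem_insert_of_mem (_root_.mem_overlaps.2 ?_)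
    have h1 := h.offset
    have h2 := h.u_le
    have h3 := h.right.1
    have h4 := h.le_v
    have h5 := h.le_u
    refine ⟨hs, by omega, by omega, fun k hk hks => ?_⟩
    rw [show u - s + k = a + (v - b + k) by omega, h.chr_eq (by omega) (by omega)]
    congr 1
    omega

/-- The cuts and the offset determine where the anchored pair starts, up to one inequality. -/
theorem IsAnchoredPair.start_le {dollar : α} {S P P' : List α} {u v s a b a' b' : ℕ}
    (h : IsAnchoredPair dollar S P u v s a b) (h' : IsAnchoredPair dollar S P' u v s a' b') :
    a ≤ a' ∧ a' + P'.length ≤ a + P.length := by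
  have o := h.offset
  have o' := h'.offset
  have := h.le_u
  have := h'.le_u
  have := h.le_v
  have := h'.le_v
  have := h.u_le
  have := h'.u_le
  have hL : a ≤ a' := by
    by_contra! hlt
    refine h.prev_ne ?_
    have := h'.chr_eq (k := a - a') (by omega) (by omega)
    rwa [show a' + (a - a') = a by omega, show b' + (a - a') = b by omega] at this
  refine ⟨hL, ?_⟩
  by_contra! hlt
  refine h.next_ne ?_
  have := h'.chr_eq (k := a + P.length + 1 - a') (by omega) (by omega)
  rwa [show a' + (a + P.length + 1 - a') = a + P.length + 1 by omega,
    show b' + (a + P.length + 1 - a') = b + P.length + 1 by omega] at this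

theorem IsAnchoredPair.unique {dollar : α} {S P P' : List α} {u v s a b a' b' : ℕ}
    (h : IsAnchoredPair dollar S P u v s a b) (h' : IsAnchoredPair dollar S P' u v s a' b') :
    P = P' ∧ a = a' ∧ b = b' := by
  obtain ⟨h1, h2⟩ := h.start_le h'
  obtain ⟨h3, h4⟩ := h'.start_le h
  have ha : a = a' := le_antisymm h1 h3
  subst ha
  have o := h.offset
  have o' := h'.offset
  have := h.le_v
  have := h'.le_v
  refine ⟨List.ext_getElem (by omega) fun k hk hk' => ?_, rfl, by omega⟩
  rw [h.left.2 k hk, h'.left.2 k hk']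

/-- Copying an occurrence of a padded substring. -/
theorem OccursAt.copy {dollar : α} {S P : List α} {a a' : ℕ} (h : OccursAt dollar S P a)
    (ha' : a' + P.length ≤ S.length)
    (heq : ∀ k ≤ P.length + 1, chr dollar S (a' + k) = chr dollar S (a + k)) :
    OccursAt dollar S P a' :=
  ⟨ha', fun k hk => by rw [h.2 k hk, add_assoc, add_assoc, heq (k + 1) (by omega)]⟩

/-- The anchored pair with parameters `u`, `v`, `s` witnesses the right extension `(P, c)` at
its first (`β = true`) or second (`β = false`) occurrence. -/
def IsWitness (dollar : α) (S : List α) (pc : List α × α) (κ : ((ℕ × ℕ) × Bool) × ℕ) : Prop :=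
  ∃ a b, IsAnchoredPair dollar S pc.1 κ.1.1.1 κ.1.1.2 κ.2 a b ∧
    pc.2 = chr dollar S ((if κ.1.2 then a else b) + pc.1.length + 1)

theorem IsWitness.unique {dollar : α} {S : List α} {pc pc' : List α × α}
    {κ : ((ℕ × ℕ) × Bool) × ℕ} (h : IsWitness dollar S pc κ) (h' : IsWitness dollar S pc' κ) :
    pc = pc' := by
  obtain ⟨a, b, hab, hc⟩ := h
  obtain ⟨a', b', hab', hc'⟩ := h'
  obtain ⟨hP, rfl, rfl⟩ := hab.unique hab'
  exact Prod.ext hP (by rw [hc, hc', hP])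

/-- The possible parameters of anchored pairs at the cuts of `L`. -/
noncomputable def anchors (dollar : α) (S : List α) (L : List (List α)) :
    Finset (((ℕ × ℕ) × Bool) × ℕ) :=
  ((cuts L ×ˢ cuts L) ×ˢ Finset.univ).biUnion fun w =>
    (insert 0 (overlaps dollar S w.1.1 w.1.2)).image fun s => (w, s)

theorem exists_isWitness [DecidableEq α] {dollar : α} {S : List α} (hdollar : dollar ∉ S)
    {L : List (List α)} (hL : IsLZ77 S L) {pc : List α × α} (hP : IsMaximalRepeat S pc.1)
    (hc : (pc.1 ++ [pc.2]) <:+: (S ++ [dollar])) :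
    ∃ κ ∈ anchors dollar S L, IsWitness dollar S pc κ := by
  obtain ⟨P, c⟩ := pc
  simp only at hP hc
  have hl : 1 ≤ P.length := List.length_pos_iff.2 hP.1
  obtain ⟨a₀, b₀, ha₀, hb₀, hac₀, hbc₀, hab₀⟩ := hP.exists_pair hdollar hc
  obtain ⟨a, haS, haeq, u, hu, hau, hua⟩ := hL.exists_copy_at_cut dollar hl a₀ ha₀.1
  obtain ⟨b, hbS, hbeq, v, hv, hbv, hvb⟩ := hL.exists_copy_at_cut dollar hl b₀ hb₀.1
  have ha := ha₀.copy haS haeq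
  have hb := hb₀.copy hbS hbeq
  have hac := (haeq (P.length + 1) le_rfl).trans hac₀
  have hbc : chr dollar S (b + P.length + 1) ≠ c := by
    rw [add_assoc, hbeq (P.length + 1) le_rfl]
    exact hbc₀
  have hab : chr dollar S a ≠ chr dollar S b := by
    have h1 := haeq 0 (Nat.zero_le _)
    have h2 := hbeq 0 (Nat.zero_le _)
    simp only [add_zero] at h1 h2
    rwa [h1, h2]
  rw [← add_assoc] at hac
  have hmem : ∀ u ∈ cuts L, ∀ v ∈ cuts L, ∀ s β a b, IsAnchoredPair dollar S P u v s a b →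
      (((u, v), β), s) ∈ anchors dollar S L := by
    intro u hu v hv s β a b h
    refine Finset.mem_biUnion.2 ⟨((u, v), β), ?_, Finset.mem_image_of_mem _ h.mem_overlaps⟩
    simp [hu, hv]
  rcases le_total (v - b) (u - a) with h | h
  · have hpair : IsAnchoredPair dollar S P u v (u - a - (v - b)) a b :=
      ⟨ha, hb, hab, by rw [hac]; exact hbc.symm, hau, hua, hbv, hvb, by omega⟩
    exact ⟨(((u, v), true), _), hmem u hu v hv _ _ a b hpair, a, b, hpair, by simp [hac]⟩
  · have hpair : IsAnchoredPair dollar S P v u (v - b - (u - a)) b a :=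
      ⟨hb, ha, hab.symm, by rw [hac]; exact hbc, hbv, hvb, hau, hua, by omega⟩
    exact ⟨(((v, u), false), _), hmem v hv u hu _ _ b a hpair, b, a, hpair, by simp [hac]⟩

theorem card_anchors_le (dollar : α) {S : List α} (L : List (List α)) {q : ℕ} (hq2 : 2 ≤ q)
    (hq : ∀ w : List α, w ≠ [] → ¬ ((List.replicate q w).flatten <:+: S)) :
    (anchors dollar S L).card ≤
      (L.length + 1) * (L.length + 1) * 2 * (2 * q * (1 + Nat.log q S.length) + 1) := by
  refine (Finset.card_biUnion_le_card_mul _ _ (2 * q * (1 + Nat.log q S.length) + 1)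
    fun w _ => ?_).trans (Nat.mul_le_mul_right _ ?_)
  · exact (Finset.card_image_le.trans (Finset.card_insert_le _ _)).trans
      (Nat.succ_le_succ (card_overlaps_le dollar hq2 hq _ _))
  · rw [Finset.card_product, Finset.card_product, Finset.card_univ, Fintype.card_bool]
    exact Nat.mul_le_mul_right _ (Nat.mul_le_mul (card_cuts_le L) (card_cuts_le L))

theorem card_right_extensions_le [DecidableEq α] {dollar : α} {S : List α}
    (hdollar : dollar ∉ S) {L : List (List α)} (hL : IsLZ77 S L) {q : ℕ} (hq2 : 2 ≤ q)
    (hq : ∀ w : List α, w ≠ [] → ¬ ((List.replicate q w).flatten <:+: S))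
    {RE : Finset (List α × α)}
    (hRE : ∀ pc ∈ RE, IsMaximalRepeat S pc.1 ∧ (pc.1 ++ [pc.2]) <:+: (S ++ [dollar])) :
    RE.card ≤ (L.length + 1) * (L.length + 1) * 2 * (2 * q * (1 + Nat.log q S.length) + 1) := by
  choose! κ hκ hwit using fun pc (hpc : pc ∈ RE) =>
    exists_isWitness hdollar hL (hRE pc hpc).1 (hRE pc hpc).2
  refine (Finset.card_le_card_of_injOn κ hκ ?_).trans (card_anchors_le dollar L hq2 hq)
  intro x hx y hy hxy
  exact (hwit x hx).unique (hxy ▸ hwit y hy)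

/-- If `S` has `z` LZ77-factors and contains no `q`-th powers, then the
number of right extensions of maximal repeats of `S` is at most
`18·q·(1 + log_q|S|)·(z+2)² − (z+1)`. -/
theorem right_extensions_bound [DecidableEq α] (dollar : α) (S : List α)
    (hdollar : dollar ∉ S)
    (L : List (List α)) (z : ℕ) (hL : IsLZ77 S L) (hz : L.length = z)
    (q : ℕ) (hq : ∀ w : List α, w ≠ [] → ¬ ((List.replicate q w).flatten <:+: S))
    (RE : Finset (List α × α))
    (hRE : ∀ pc ∈ RE, IsMaximalRepeat S pc.1 ∧ (pc.1 ++ [pc.2]) <:+: (S ++ [dollar])) :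
    (RE.card : ℝ) ≤ 18 * (q : ℝ) * (1 + Real.logb (q : ℝ) (S.length : ℝ)) * ((z : ℝ) + 2) ^ 2
      - ((z : ℝ) + 1) := by
  subst hz
  rcases Nat.lt_or_ge q 2 with hq1 | hq2
  · have hS : S = [] := by
      by_contra hne
      refine hq S hne ?_
      interval_cases q <;> simp
    have hempty : RE = ∅ := by
      refine Finset.eq_empty_of_forall_notMem fun pc hpc => ?_
      obtain ⟨hP, hc⟩ := hRE pc hpc
      obtain ⟨a, ha, -⟩ := exists_occursAt_of_infix dollar hc
      have h1 := ha.1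
      have h2 := List.length_pos_iff.2 hP.1
      rw [hS, List.length_nil] at h1
      omega
    have hq0 : q = 1 := by
      by_contra hne
      exact hq [dollar] (by simp) (by rw [show q = 0 by omega]; simp)
    subst hq0
    rw [hempty]
    simp
    nlinarith [(Nat.cast_nonneg L.length : (0 : ℝ) ≤ L.length)]
  · have hcard := card_right_extensions_le hdollar hL hq2 hq hRE
    have hlog : (Nat.log q S.length : ℝ) ≤ Real.logb q S.length := Real.natLog_le_logb _ _
    have hcard' : (RE.card : ℝ) ≤ ((L.length : ℝ) + 1) * (L.length + 1) * 2 *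
        (2 * q * (1 + Nat.log q S.length) + 1) := by exact_mod_cast hcard
    set x : ℝ := Real.logb q S.length
    set y : ℝ := ((Nat.log q S.length : ℕ) : ℝ)
    set z : ℝ := ((L.length : ℕ) : ℝ)
    have hy : 0 ≤ y := Nat.cast_nonneg _
    have hz : 0 ≤ z := Nat.cast_nonneg _
    have hq' : (2 : ℝ) ≤ q := by exact_mod_cast hq2
    have hX : (2 : ℝ) ≤ q * (1 + x) := by nlinarith
    have hyx : (q : ℝ) * (1 + y) ≤ q * (1 + x) := by gcongr
    set X : ℝ := q * (1 + x)
    have h1 : (z + 1) * (z + 1) * 2 * (2 * q * (1 + y) + 1) ≤ (z + 1) * (z + 1) * 2 * (3 * X) :=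
      mul_le_mul_of_nonneg_left (by linarith) (by positivity)
    have h2 : (z + 1) * (z + 1) * 2 * (3 * X) ≤ 6 * X * (z + 2) ^ 2 := by nlinarith
    have h3 : z + 1 ≤ 12 * X * (z + 2) ^ 2 := by nlinarith [sq_nonneg z]
    have h4 : 18 * q * (1 + x) * (z + 2) ^ 2 = 18 * X * (z + 2) ^ 2 := by ring
    linarith
end

section
/- Let S be a string, let F₁F₂⋯F_zF_{z+1} = S$ be the LZ77-decomposition of S$, and let s₁, s₂, …, s_{z+1} be the starting indices of the LZ77-factors in S$. Let q ≥ 2 be a natural number and let i, j ∈ {1, …, z+1}. Then the number of different maximal pairs (n_k, m_k, l_k) of S such that for all k: (a) the substring S[n_k..s_i−1] is not a fractional power with exponent ≥ q, (b) the substring S[s_i..n_k+l_k−1] is not a fractional power with exponent ≥ q, (c) s_i ∈ [n_k, n_k+l_k], (d) s_{i+1} ∉ [n_k, n_k+l_k], and (e) s_j ∈ [m_k, m_k+l_k], is at most 18·q·⌈log_q(|F₁F₂⋯F_i|)⌉. -/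
variable {α : Type*}

/-- The `x` characters of `u` immediately to the left of position `0` have period `p`. -/
def LeftPeriodic (u : ℤ → α) (x p : ℕ) : Prop :=
  ∀ k : ℤ, -(x : ℤ) ≤ k → k + p < 0 → u k = u (k + p)

/-- The `x` characters of `u` immediately to the left of `0` reoccur in `v`, shifted by `δ`, with
`0 ≤ δ ≤ x`, and they do not form a power of exponent at least `q`. -/
structure LeftMatch (u v : ℤ → α) (q : ℕ) (δ : ℤ) (x : ℕ) : Prop where
  nonneg : 0 ≤ δ
  le : δ ≤ x
  eq : ∀ k : ℤ, -(x : ℤ) ≤ k → k < 0 → u k = v (k + δ)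
  not_pow : ∀ p : ℕ, 1 ≤ p → q * p ≤ x → ¬ LeftPeriodic u x p

/-- A family of integers in `[0, Q * g)` with pairwise distances at least `g` has at most `Q`
members. -/
lemma card_le_of_separated {ι : Type*} (T : Finset ι) (f : ι → ℤ) (g : ℤ) (Q : ℕ) (hg : 0 < g)
    (hf : ∀ t ∈ T, 0 ≤ f t ∧ f t < Q * g)
    (hsep : ∀ s ∈ T, ∀ t ∈ T, s ≠ t → f s ≤ f t → g ≤ f t - f s) : T.card ≤ Q := by
  have key : ∀ s ∈ T, ∀ t ∈ T, s ≠ t → f s ≤ f t → f s / g < f t / g := by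
    intro s hs t ht hst hle
    have h1 := hsep s hs t ht hst hle
    have h2 : f s / g + 1 ≤ f t / g := by
      rw [Int.le_ediv_iff_mul_le hg, add_mul, one_mul]
      have := Int.ediv_mul_le (f s) hg.ne'
      linarith
    omega
  have hcard := Finset.card_le_card_of_injOn (s := T) (t := Finset.Ico (0 : ℤ) Q)
    (fun t => f t / g)
    (by
      intro t ht
      have h := hf t ht
      simp only [Finset.coe_Ico, Set.mem_Ico]
      exact ⟨Int.ediv_nonneg h.1 hg.le, Int.ediv_lt_of_lt_mul hg h.2⟩)
    (by
      intro s hs t ht hst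
      by_contra hne
      simp only at hst
      rcases le_total (f s) (f t) with h | h
      · exact absurd hst (key s hs t ht hne h).ne
      · exact absurd hst (key t ht s hs (Ne.symm hne) h).ne')
  simpa using hcard

lemma LeftMatch.leftPeriodic {u v : ℤ → α} {q : ℕ} {δ δ' : ℤ} {x x' : ℕ}
    (h : LeftMatch u v q δ x) (h' : LeftMatch u v q δ' x') {y p : ℕ} (hy : y ≤ x) (hy' : y ≤ x')
    (hp : (p : ℤ) = δ' - δ) : LeftPeriodic u y p := by
  intro k hk hkp
  rw [h'.eq k (by omega) (by omega), h.eq (k + p) (by omega) hkp]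
  congr 1
  omega

/-- Left matches with distinct shifts and lengths in `[A, q * A)` number at most `3 * q`. -/
lemma card_leftMatch_le_of_length {ι : Type*} (u v : ℤ → α) (q A : ℕ) (hA : 1 ≤ A)
    (T : Finset ι) (δ : ι → ℤ) (x : ι → ℕ) (hinj : Set.InjOn δ T)
    (hT : ∀ t ∈ T, LeftMatch u v q (δ t) (x t)) (hx : ∀ t ∈ T, A ≤ x t ∧ x t < q * A) :
    T.card ≤ 3 * q := by
  classical
  have hex : ∃ g : ℕ, 1 ≤ g ∧ LeftPeriodic u A g := ⟨A, hA, fun k h1 h2 => by omega⟩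
  obtain ⟨g, ⟨hg1, hgA⟩, hgmin⟩ :
      ∃ g : ℕ, (1 ≤ g ∧ LeftPeriodic u A g) ∧ ∀ p, 1 ≤ p → LeftPeriodic u A p → g ≤ p :=
    ⟨Nat.find hex, Nat.find_spec hex, fun p h1 h2 => Nat.find_min' hex ⟨h1, h2⟩⟩
  have hpos : ∀ s ∈ T, ∀ t ∈ T, s ≠ t → δ s ≤ δ t → δ s < δ t := fun s hs t ht hst hle =>
    lt_of_le_of_ne hle fun h => hst (hinj hs ht h)
  have hsep : ∀ s ∈ T, ∀ t ∈ T, s ≠ t → δ s ≤ δ t → (g : ℤ) ≤ δ t - δ s := by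
    intro s hs t ht hst hle
    have hlt := hpos s hs t ht hst hle
    obtain ⟨p, hp⟩ := Int.eq_ofNat_of_zero_le (sub_nonneg.2 hle)
    have := hgmin p (by omega)
      ((hT s hs).leftPeriodic (hT t ht) (hx s hs).1 (hx t ht).1 hp.symm)
    omega
  have hper : (T.filter fun t => LeftPeriodic u (x t) g).card ≤ q := by
    refine card_le_of_separated _ δ g q (by omega) ?_ ?_
    · intro t ht
      obtain ⟨ht, htg⟩ := Finset.mem_filter.1 ht
      refine ⟨(hT t ht).nonneg, ?_⟩
      have h1 : x t < q * g := by
        by_contra! h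
        exact (hT t ht).not_pow g hg1 h htg
      have h2 := (hT t ht).le
      have h3 : (x t : ℤ) < q * g := by exact_mod_cast h1
      omega
    · intro s hs t ht
      exact hsep s (Finset.mem_filter.1 hs).1 t (Finset.mem_filter.1 ht).1
  have hnper : (T.filter fun t => ¬ LeftPeriodic u (x t) g).card ≤ 2 * q := by
    have hbreak : ∀ y : ℕ, ¬ LeftPeriodic u y g →
        ∃ e : ℕ, e ≤ y ∧ g < e ∧ u (-(e : ℤ)) ≠ u (-(e : ℤ) + g) := by
      intro y hy
      unfold LeftPeriodic at hy
      push Not at hy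
      obtain ⟨k, h1, h2, h3⟩ := hy
      refine ⟨(-k).toNat, by omega, by omega, ?_⟩
      rwa [show -((-k).toNat : ℤ) = k by omega]
    refine card_le_of_separated _ (fun t => 2 * δ t) A (2 * q) (by omega) ?_ ?_
    · intro t ht
      have ht := (Finset.mem_filter.1 ht).1
      have h1 := (hT t ht).nonneg
      have h2 := (hT t ht).le
      have h3 : (x t : ℤ) < q * A := by exact_mod_cast (hx t ht).2
      refine ⟨by linarith, ?_⟩
      push_cast
      linarith
    · intro s hs t ht hst hle
      obtain ⟨hs, hsg⟩ := Finset.mem_filter.1 hs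
      obtain ⟨ht, htg⟩ := Finset.mem_filter.1 ht
      have hle : δ s ≤ δ t := by linarith
      have hlt := hpos s hs t ht hst hle
      have hgp := hsep s hs t ht hst hle
      obtain ⟨p, hp⟩ := Int.eq_ofNat_of_zero_le (sub_nonneg.2 hle)
      have hE : ∃ e : ℕ, g < e ∧ u (-(e : ℤ)) ≠ u (-(e : ℤ) + g) :=
        (hbreak _ hsg).imp fun e he => he.2
      obtain ⟨e, ⟨hge, hue⟩, hemin⟩ : ∃ e : ℕ, (g < e ∧ u (-(e : ℤ)) ≠ u (-(e : ℤ) + g)) ∧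
          ∀ e' : ℕ, g < e' → u (-(e' : ℤ)) ≠ u (-(e' : ℤ) + g) → e ≤ e' :=
        ⟨Nat.find hE, Nat.find_spec hE, fun e' h1 h2 => Nat.find_min' hE ⟨h1, h2⟩⟩
      have hes : e ≤ x s := by
        obtain ⟨e', h1, h2, h3⟩ := hbreak _ hsg
        exact (hemin e' h2 h3).trans h1
      have het : e ≤ x t := by
        obtain ⟨e', h1, h2, h3⟩ := hbreak _ htg
        exact (hemin e' h2 h3).trans h1
      have hAe : A < e := by
        by_contra! h
        exact hue (hgA _ (by omega) (by omega))
      have hpe := (hT s hs).leftPeriodic (hT t ht) hes het hp.symm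
      have hep : e ≤ p + g := by
        by_contra! h
        apply hue
        have h1 := hpe (-(e : ℤ)) le_rfl (by omega)
        have h2 : u (-(e : ℤ) + p) = u (-(e : ℤ) + p + g) := by
          by_contra hne
          have hc : -((e - p : ℕ) : ℤ) = -(e : ℤ) + p := by omega
          have := hemin (e - p) (by omega) (by rwa [hc])
          omega
        have h3 := hpe (-(e : ℤ) + g) (by omega) (by omega)
        rw [h1, h2, h3]
        congr 1
        ring
      omega
  have := Finset.card_filter_add_card_filter_not (s := T) (fun t => LeftPeriodic u (x t) g)
  omega

/-- Left matches with distinct shifts and lengths in `[1, q ^ K)` number at most `3 * q * K`. -/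
lemma card_leftMatch_le {ι : Type*} (u v : ℤ → α) (q K : ℕ) (hq : 2 ≤ q)
    (T : Finset ι) (δ : ι → ℤ) (x : ι → ℕ) (hinj : Set.InjOn δ T)
    (hT : ∀ t ∈ T, LeftMatch u v q (δ t) (x t)) (hx : ∀ t ∈ T, 1 ≤ x t ∧ x t < q ^ K) :
    T.card ≤ 3 * q * K := by
  classical
  have := Finset.card_le_mul_card_image_of_maps_to (s := T) (t := Finset.range K)
    (f := fun t => Nat.log q (x t))
    (fun t ht => by
      have h := hx t ht
      exact Finset.mem_range.2 (Nat.log_lt_of_lt_pow (by omega) h.2)) (3 * q)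
    (fun k _ => by
      refine card_leftMatch_le_of_length u v q (q ^ k) (Nat.one_le_pow _ _ (by omega)) _ δ x
        (hinj.mono (Finset.coe_subset.2 (Finset.filter_subset _ _)))
        (fun t ht => hT t (Finset.mem_filter.1 ht).1) ?_
      intro t ht
      obtain ⟨htT, rfl⟩ := Finset.mem_filter.1 ht
      have h := hx t htT
      refine ⟨Nat.pow_log_le_self q (by omega), ?_⟩
      rw [← pow_succ']
      exact Nat.lt_pow_succ_log_self (by omega) _)
  simpa using this

lemma isFracPowGe_substr {dollar : α} {S : List α} {q lo hi p : ℕ} (hp : 1 ≤ p)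
    (hlen : q * p ≤ hi + 1 - lo)
    (h : ∀ k, k + p < hi + 1 - lo → chr dollar S (lo + k) = chr dollar S (lo + (k + p))) :
    IsFracPowGe q (substr dollar S lo hi) := by
  have hper : IsPeriodOf p (substr dollar S lo hi) := by
    refine ⟨hp, fun k hk => ?_⟩
    simp only [substr, List.length_map, List.length_range] at hk
    simpa [substr] using h k hk
  have hmin : minPeriod (substr dollar S lo hi) ≤ p := Nat.sInf_le hper
  calc q * minPeriod (substr dollar S lo hi) ≤ q * p := Nat.mul_le_mul_left _ hmin
    _ ≤ _ := by simpa [substr] using hlen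

/-- Two maximal pairs on the same diagonal whose first occurrences both touch position `a`
coincide. -/
lemma IsMaximalPair.eq_of_diagonal {dollar : α} {S : List α} {n m l n' m' l' a : ℕ}
    (h : IsMaximalPair dollar S n m l) (h' : IsMaximalPair dollar S n' m' l')
    (hn : n ≤ a) (hl : a ≤ n + l) (hn' : n' ≤ a) (hl' : a ≤ n' + l')
    (hd : n + m' = n' + m) : n = n' ∧ m = m' ∧ l = l' := by
  obtain ⟨-, h1, h2, -, -, heq, hL, hR⟩ := h
  obtain ⟨-, h1', h2', -, -, heq', hL', hR'⟩ := h'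
  have hnn : n = n' := by
    rcases lt_trichotomy n n' with hlt | rfl | hlt
    · refine absurd ?_ hL'
      have := heq (n' - 1 - n) (by omega)
      rwa [show n + (n' - 1 - n) = n' - 1 by omega, show m + (n' - 1 - n) = m' - 1 by omega]
        at this
    · rfl
    · refine absurd ?_ hL
      have := heq' (n - 1 - n') (by omega)
      rwa [show n' + (n - 1 - n') = n - 1 by omega, show m' + (n - 1 - n') = m - 1 by omega]
        at this
  subst hnn
  obtain rfl : m = m' := by omega
  refine ⟨rfl, rfl, ?_⟩
  rcases lt_trichotomy l l' with hlt | rfl | hlt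
  · exact absurd (heq' l hlt) hR
  · rfl
  · exact absurd (heq l' hlt) hR'

/-- The part of a maximal pair to the left of the anchors `a` and `b`. -/
lemma IsMaximalPair.leftMatch {dollar : α} {S : List α} {q n m l a b : ℕ}
    (h : IsMaximalPair dollar S n m l) (hn : n ≤ a) (hl : a ≤ n + l) (hm : m ≤ b)
    (hpow : ¬ IsFracPowGe q (substr dollar S n (a - 1)))
    (hδ : 0 ≤ (a : ℤ) - n + m - b) :
    LeftMatch (fun k => chr dollar S (a + k).toNat) (fun k => chr dollar S (b + k).toNat) q
      ((a : ℤ) - n + m - b) (a - n) := by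
  obtain ⟨-, h1, -, -, -, heq, -, -⟩ := h
  refine ⟨hδ, by omega, fun k hk hk0 => ?_, fun p hp hqp hper => hpow ?_⟩
  · have := heq (a + k - n).toNat (by omega)
    convert this using 2 <;> omega
  · refine isFracPowGe_substr hp (by omega) fun k hk => ?_
    have := hper (n + k - a) (by omega) (by omega)
    convert this using 2 <;> omega

/-- The part of a maximal pair to the right of the anchors `a` and `b`, read backwards. -/
lemma IsMaximalPair.rightMatch {dollar : α} {S : List α} {q n m l a b : ℕ}
    (h : IsMaximalPair dollar S n m l) (hn : n ≤ a) (hl : a ≤ n + l) (hm : b ≤ m + l)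
    (hpow : ¬ IsFracPowGe q (substr dollar S a (n + l - 1)))
    (hδ : (a : ℤ) - n + m - b ≤ 0) :
    LeftMatch (fun k => chr dollar S (a + (-1 - k)).toNat)
      (fun k => chr dollar S (b + (-1 - k)).toNat) q
      (-((a : ℤ) - n + m - b)) (n + l - a) := by
  obtain ⟨-, h1, -, -, -, heq, -, -⟩ := h
  refine ⟨by omega, by omega, fun k hk hk0 => ?_, fun p hp hqp hper => hpow ?_⟩
  · have := heq (a + (-1 - k) - n).toNat (by omega)
    convert this using 2 <;> omega
  · refine isFracPowGe_substr hp (by omega) fun k hk => ?_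
    have := hper (-1 - k - p) (by omega) (by omega)
    convert this.symm using 2 <;> omega

/-- At most `6 * q * K + 1` maximal pairs with power-free halves touch the anchors `a` and `b`
when both halves at `a` are shorter than `q ^ K`. -/
lemma card_maximalPairs_at_anchors_le (dollar : α) (S : List α) (q K a b : ℕ) (hq : 2 ≤ q)
    (M : Finset (ℕ × ℕ × ℕ))
    (hmax : ∀ p ∈ M, IsMaximalPair dollar S p.1 p.2.1 p.2.2)
    (hleft : ∀ p ∈ M, ¬ IsFracPowGe q (substr dollar S p.1 (a - 1)))
    (hright : ∀ p ∈ M, ¬ IsFracPowGe q (substr dollar S a (p.1 + p.2.2 - 1)))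
    (ha : ∀ p ∈ M, p.1 ≤ a ∧ a ≤ p.1 + p.2.2) (hb : ∀ p ∈ M, p.2.1 ≤ b ∧ b ≤ p.2.1 + p.2.2)
    (hlen : ∀ p ∈ M, a - p.1 < q ^ K ∧ p.1 + p.2.2 - a < q ^ K) :
    M.card ≤ 6 * q * K + 1 := by
  classical
  set δ : ℕ × ℕ × ℕ → ℤ := fun p => (a : ℤ) - p.1 + p.2.1 - b with hδ
  have hinj : Set.InjOn δ M := by
    rintro ⟨n, m, l⟩ hp ⟨n', m', l'⟩ hp' h
    simp only [hδ] at h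
    obtain ⟨h1, h2, h3⟩ := (hmax _ hp).eq_of_diagonal (hmax _ hp') (ha _ hp).1 (ha _ hp).2
      (ha _ hp').1 (ha _ hp').2 (by simp only; omega)
    simp_all
  have hpos : (M.filter fun p => 0 < δ p).card ≤ 3 * q * K := by
    refine card_leftMatch_le (fun k => chr dollar S (a + k).toNat)
      (fun k => chr dollar S (b + k).toNat) q K hq _ δ (fun p => a - p.1)
      (hinj.mono (Finset.coe_subset.2 (Finset.filter_subset _ _)))
      (fun p hp => ?_) (fun p hp => ?_) <;> obtain ⟨hp, h0⟩ := Finset.mem_filter.1 hp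
    · exact (hmax p hp).leftMatch (ha p hp).1 (ha p hp).2 (hb p hp).1 (hleft p hp) h0.le
    · have h1 := ha p hp
      have h2 := hb p hp
      simp only [hδ] at h0
      exact ⟨by omega, (hlen p hp).1⟩
  have hneg : (M.filter fun p => δ p < 0).card ≤ 3 * q * K := by
    refine card_leftMatch_le (fun k => chr dollar S (a + (-1 - k)).toNat)
      (fun k => chr dollar S (b + (-1 - k)).toNat) q K hq _ (fun p => -δ p) (fun p => p.1 + p.2.2 - a)
      (fun p hp p' hp' h => hinj (Finset.mem_filter.1 hp).1 (Finset.mem_filter.1 hp').1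
        (neg_injective h))
      (fun p hp => ?_) (fun p hp => ?_) <;> obtain ⟨hp, h0⟩ := Finset.mem_filter.1 hp
    · exact (hmax p hp).rightMatch (ha p hp).1 (ha p hp).2 (hb p hp).2 (hright p hp) h0.le
    · have h1 := ha p hp
      have h2 := hb p hp
      simp only [hδ] at h0
      exact ⟨by omega, (hlen p hp).2⟩
  have hzero : (M.filter fun p => δ p = 0).card ≤ 1 := by
    refine Finset.card_le_one.2 fun p hp p' hp' => ?_
    obtain ⟨hp, h0⟩ := Finset.mem_filter.1 hp
    obtain ⟨hp', h0'⟩ := Finset.mem_filter.1 hp'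
    exact hinj hp hp' (h0.trans h0'.symm)
  have hcover : M ⊆ (M.filter fun p => 0 < δ p) ∪ (M.filter fun p => δ p < 0) ∪
      (M.filter fun p => δ p = 0) := by
    intro p hp
    simp only [Finset.mem_union, Finset.mem_filter, hp, true_and]
    omega
  have h1 := (Finset.card_le_card hcover).trans (Finset.card_union_le _ _)
  have h2 := Finset.card_union_le (M.filter fun p => 0 < δ p) (M.filter fun p => δ p < 0)
  linarith

/-- Theorem 8 of Pape-Lange. Counting maximal pairs around the boundaries
`s i`, `s j` of LZ77-factors of `S$` which neither begin nor end with a power of exponent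
`≥ q`: there are at most `18·q·⌈log_q(|F₁F₂⋯F_i|)⌉` of them. -/
theorem maximal_pairs_at_lz77_boundaries (dollar : α) (S : List α)
    (hdollar : dollar ∉ S)
    (L : List (List α)) (z : ℕ) (hL : IsLZ77 (S ++ [dollar]) L) (hz : L.length = z + 1)
    (q : ℕ) (hq : 2 ≤ q)
    (i j : ℕ) (hi : 1 ≤ i ∧ i ≤ z + 1) (hj : 1 ≤ j ∧ j ≤ z + 1)
    (s : ℕ → ℕ) (hs : ∀ t, s t = ((L.take (t - 1)).flatten).length + 1)
    (M : Finset (ℕ × ℕ × ℕ))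
    (hM : ∀ p ∈ M, IsMaximalPair dollar S p.1 p.2.1 p.2.2 ∧
      ¬ IsFracPowGe q (substr dollar S p.1 (s i - 1)) ∧
      ¬ IsFracPowGe q (substr dollar S (s i) (p.1 + p.2.2 - 1)) ∧
      (p.1 ≤ s i ∧ s i ≤ p.1 + p.2.2) ∧
      ¬ (p.1 ≤ s (i + 1) ∧ s (i + 1) ≤ p.1 + p.2.2) ∧
      (p.2.1 ≤ s j ∧ s j ≤ p.2.1 + p.2.2)) :
    (M.card : ℝ) ≤ 18 * (q : ℝ) * (⌈Real.logb (q : ℝ) ((((L.take i).flatten).length : ℕ) : ℝ)⌉ : ℝ) := by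
  rcases M.eq_empty_or_nonempty with rfl | hne
  · have h0 : (0 : ℝ) ≤ Real.logb q (((L.take i).flatten.length : ℕ) : ℝ) :=
      div_nonneg (Real.log_natCast_nonneg _) (Real.log_natCast_nonneg _)
    have h1 : (0 : ℝ) ≤ ⌈Real.logb q (((L.take i).flatten.length : ℕ) : ℝ)⌉ :=
      h0.trans (Int.le_ceil _)
    rw [Finset.card_empty, Nat.cast_zero]
    exact mul_nonneg (by positivity) h1
  set N := (L.take i).flatten.length with hN
  have hmono : s i ≤ s (i + 1) := by
    rw [hs, hs]
    have : (L.take (i - 1)).Sublist (L.take i) := List.take_sublist_take_left (by omega)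
    simpa using this.flatten.length_le
  have hsucc : s (i + 1) = N + 1 := by simp [hs, hN]
  have hspos : 1 ≤ s i := by rw [hs]; omega
  have hbound : ∀ p ∈ M, 2 ≤ N ∧ s i - p.1 < N ∧ p.1 + p.2.2 - s i < N := by
    intro p hp
    obtain ⟨⟨h1, h2, -⟩, -, -, h3, h4, -⟩ := hM p hp
    omega
  have hpow : N ≤ q ^ Nat.clog q N := Nat.le_pow_clog (by omega) N
  have hcard := card_maximalPairs_at_anchors_le dollar S q (Nat.clog q N) (s i) (s j) hq M
    (fun p hp => (hM p hp).1) (fun p hp => (hM p hp).2.1) (fun p hp => (hM p hp).2.2.1)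
    (fun p hp => (hM p hp).2.2.2.1) (fun p hp => (hM p hp).2.2.2.2.2)
    (fun p hp => ⟨(hbound p hp).2.1.trans_le hpow, (hbound p hp).2.2.trans_le hpow⟩)
  obtain ⟨p, hp⟩ := hne
  have hclog : 1 ≤ Nat.clog q N := Nat.clog_pos (by omega) (hbound p hp).1
  have hceil : ⌈Real.logb (q : ℝ) (N : ℝ)⌉ = (Nat.clog q N : ℤ) := by
    rw [Real.ceil_logb_natCast (by positivity), Int.clog_natCast]
  rw [hceil]
  have hfin : M.card ≤ 18 * q * Nat.clog q N := by
    have : 1 ≤ q * Nat.clog q N := Nat.mul_pos (by omega) hclog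
    nlinarith
  exact_mod_cast hfin
end

section
/- Let S be a string, let q ≥ 2 be a natural number, and let i, j be indices of characters in S$. Then there are at most 18·q·⌈log_q(|S$|)⌉ different maximal pairs (n_k, m_k, l_k) of S such that for all k: (a) the substring S[n_k..i−1] is not a fractional power with exponent ≥ q, (b) the substring S[i..n_k+l_k−1] is not a fractional power with exponent ≥ q, (c) i ∈ [n_k, n_k+l_k], and (d) j ∈ [m_k, m_k+l_k]. -/
variable {α : Type*}

/-- `d` is a period of the length-`t` prefix of the infinite word `u`. -/
def PrefixPeriod (u : ℕ → α) (t d : ℕ) : Prop :=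
  1 ≤ d ∧ ∀ k, k + d < t → u k = u (k + d)

/-- The least period of the length-`t` prefix of `u`. -/
noncomputable def leastPeriod (u : ℕ → α) (t : ℕ) : ℕ := sInf {d | PrefixPeriod u t d}

theorem PrefixPeriod.mono {u : ℕ → α} {s t d : ℕ} (h : PrefixPeriod u t d) (hst : s ≤ t) :
    PrefixPeriod u s d :=
  ⟨h.1, fun k hk => h.2 k (by omega)⟩

theorem leastPeriod_le {u : ℕ → α} {t d : ℕ} (h : PrefixPeriod u t d) : leastPeriod u t ≤ d :=
  Nat.sInf_le h

theorem prefixPeriod_leastPeriod (u : ℕ → α) (t : ℕ) : PrefixPeriod u t (leastPeriod u t) :=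
  Nat.sInf_mem (s := {d | PrefixPeriod u t d}) ⟨t + 1, by omega, fun k hk => by omega⟩

theorem leastPeriod_pos (u : ℕ → α) (t : ℕ) : 1 ≤ leastPeriod u t :=
  (prefixPeriod_leastPeriod u t).1

theorem leastPeriod_le_self (u : ℕ → α) {t : ℕ} (ht : 1 ≤ t) : leastPeriod u t ≤ t :=
  leastPeriod_le ⟨ht, fun k hk => by omega⟩

theorem leastPeriod_mono (u : ℕ → α) : Monotone (leastPeriod u) := fun _ t hst =>
  leastPeriod_le ((prefixPeriod_leastPeriod u t).mono hst)

/-- A period of a prefix that, together with the least one, fits into the prefix is a multiple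
of the least one (a weak form of the Fine–Wilf theorem). -/
theorem leastPeriod_dvd {u : ℕ → α} {t d : ℕ} (h : PrefixPeriod u t d)
    (hd : leastPeriod u t + d ≤ t) : leastPeriod u t ∣ d := by
  induction d using Nat.strong_induction_on with
  | _ d ih =>
    obtain ⟨hv1, hv⟩ := prefixPeriod_leastPeriod u t
    have hle := leastPeriod_le h
    set v := leastPeriod u t
    rcases hle.eq_or_lt with he | hlt
    · exact he ▸ dvd_rfl
    · have hper : PrefixPeriod u t (d - v) := by
        refine ⟨by omega, fun k hk => ?_⟩
        by_cases hkd : k + d < t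
        · rw [h.2 k hkd, hv (k + (d - v)) (by omega)]
          congr 1
          omega
        · have h1 := hv (k - v) (by omega)
          rw [Nat.sub_add_cancel (by omega)] at h1
          rw [← h1, h.2 (k - v) (by omega)]
          congr 1
          omega
      have := ih (d - v) (by omega) hper (by omega)
      rw [← Nat.sub_add_cancel hle]
      exact this.add dvd_rfl

theorem PrefixPeriod.apply_mod {u : ℕ → α} {t d : ℕ} (h : PrefixPeriod u t d) {k : ℕ}
    (hk : k < t) : u k = u (k % d) := by
  induction k using Nat.strong_induction_on with
  | _ k ih =>
    have hd := h.1
    by_cases hkd : k < d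
    · rw [Nat.mod_eq_of_lt hkd]
    · have h1 := h.2 (k - d) (by omega)
      rw [Nat.sub_add_cancel (by omega)] at h1
      rw [← h1, ih (k - d) (by omega) (by omega), Nat.mod_eq_sub_mod (by omega : d ≤ k)]

theorem lt_leastPeriod_add {u : ℕ → α} {s t : ℕ} (hlt : leastPeriod u s < leastPeriod u t) :
    s < leastPeriod u t + leastPeriod u s := by
  by_contra! hle
  have hst : s ≤ t := by
    by_contra! h
    exact absurd (leastPeriod_mono u h.le) (by omega)
  have hs := prefixPeriod_leastPeriod u s
  have ht := prefixPeriod_leastPeriod u t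
  have hdvd : leastPeriod u s ∣ leastPeriod u t := leastPeriod_dvd (ht.mono hst) (by omega)
  have hred : ∀ k < t, u k = u (k % leastPeriod u s) := fun k hk => by
    have hm : k % leastPeriod u t < leastPeriod u t := Nat.mod_lt _ ht.1
    rw [ht.apply_mod hk, hs.apply_mod (by omega : k % leastPeriod u t < s),
      Nat.mod_mod_of_dvd _ hdvd]
  have : PrefixPeriod u t (leastPeriod u s) := by
    refine ⟨hs.1, fun k hk => ?_⟩
    rw [hred k (by omega), hred _ hk, Nat.add_mod_right]
  exact absurd (leastPeriod_le this) (by omega)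

theorem Nat.pow_le_one_add_pow {s q : ℕ} (hs : 1 ≤ s) (hsq : s ≤ q) : q ^ s ≤ (1 + s) ^ q := by
  have hs' : (0 : ℝ) < s := by exact_mod_cast hs
  have h1 : (1 : ℝ) ≤ (q : ℝ) / s := by
    rw [le_div_iff₀ hs', one_mul]
    exact_mod_cast hsq
  have h2 := one_add_mul_self_le_rpow_one_add (s := (s : ℝ)) (by linarith) h1
  rw [div_mul_cancel₀ _ hs'.ne'] at h2
  have h3 : ((q : ℝ)) ^ s ≤ ((1 + (s : ℝ)) ^ ((q : ℝ) / s)) ^ s :=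
    pow_le_pow_left₀ (by positivity) (by linarith) s
  rw [← Real.rpow_natCast (_ ^ _) s, ← Real.rpow_mul (by positivity),
    div_mul_cancel₀ _ hs'.ne', Real.rpow_natCast] at h3
  exact_mod_cast h3

theorem potential_growth {z v s x w : ℕ} (hs : 1 ≤ s) (hvz : v ≤ z)
    (hx : z + s * v ≤ x) (hvw : v < w) (hw : z + s * v < w + 2 * v) :
    z ^ 2 * v * (1 + s) ≤ x ^ 2 * w := by
  rcases hs.eq_or_lt with rfl | hs
  · rcases lt_or_ge z (2 * v) with h | h
    · have h1 : 2 * z ^ 2 ≤ (z + v) ^ 2 := by nlinarith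
      calc z ^ 2 * v * (1 + 1) = 2 * z ^ 2 * v := by ring
        _ ≤ x ^ 2 * w := Nat.mul_le_mul
            (h1.trans (Nat.pow_le_pow_left (by omega) 2)) hvw.le
    · obtain ⟨t, rfl⟩ := Nat.exists_eq_add_of_le h
      calc (2 * v + t) ^ 2 * v * (1 + 1) ≤ (3 * v + t) ^ 2 * (v + t) := by
            nlinarith [Nat.zero_le (v ^ 3), Nat.zero_le (v ^ 2 * t), Nat.zero_le (v * t ^ 2),
              Nat.zero_le (t ^ 3)]
        _ ≤ x ^ 2 * w := Nat.mul_le_mul (Nat.pow_le_pow_left (by omega) 2) (by omega)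
  · obtain ⟨r, rfl⟩ := Nat.exists_eq_add_of_le (show 2 ≤ s from hs)
    have h1 : (2 + r) * v = 2 * v + r * v := by ring
    calc z ^ 2 * v * (1 + (2 + r)) ≤ (z + (2 + r) * v) ^ 2 * z := by
          have := Nat.mul_le_mul_left (z ^ 2) hvz
          nlinarith [Nat.zero_le (z ^ 2 * v * r), Nat.zero_le (z ^ 2 * v),
            Nat.zero_le (((2 + r) * v) ^ 2 * z)]
      _ ≤ x ^ 2 * w := Nat.mul_le_mul (Nat.pow_le_pow_left hx 2) (by omega)

/-- `u` aligned at the displacement `-x` of the text `w` agrees with it on a prefix of length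
at least `x` which is no `q`-th power. -/
def Anchored (q : ℕ) (u : ℕ → α) (w : ℤ → α) (x : ℕ) : Prop :=
  1 ≤ x ∧ ∃ b, x ≤ b ∧ b < q * leastPeriod u b ∧ ∀ k < b, u k = w ((k : ℤ) - x)

theorem Anchored.gap {q : ℕ} {u : ℕ → α} {w : ℤ → α} {x y : ℕ} (hx : Anchored q u w x)
    (hy : Anchored q u w y) (hxy : x < y) :
    ∃ c, x ≤ c ∧ c < q * leastPeriod u c ∧ x + leastPeriod u c ≤ y := by
  obtain ⟨-, b, hxb, hb, hbw⟩ := hx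
  obtain ⟨-, b', hyb, hb', hbw'⟩ := hy
  have hper : PrefixPeriod u (min b b') (y - x) := by
    refine ⟨by omega, fun k hk => ?_⟩
    rw [hbw k (by omega), hbw' (k + (y - x)) (by omega)]
    congr 1
    omega
  refine ⟨min b b', by omega, ?_, ?_⟩
  · rcases min_choice b b' with h | h <;> rw [h] <;> assumption
  · have := leastPeriod_le hper
    omega

theorem Anchored.add_leastPeriod_le {q : ℕ} {u : ℕ → α} {w : ℤ → α} {x y : ℕ}
    (hx : Anchored q u w x) (hy : Anchored q u w y) (hxy : x < y) :
    x + leastPeriod u x ≤ y := by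
  obtain ⟨c, hc, -, hle⟩ := hx.gap hy hxy
  have := leastPeriod_mono u hc
  omega

/-- Points at mutual distance at least `v` spread over a long interval. -/
theorem separated_card_le {Y : Finset ℕ} {v z y : ℕ} (hz : z ∈ Y)
    (hmin : ∀ a ∈ Y, z ≤ a) (hmax : ∀ a ∈ Y, a ≤ y)
    (hsep : ∀ a ∈ Y, ∀ b ∈ Y, a < b → a + v ≤ b) : z + Y.card * v ≤ y + v := by
  induction Y using Finset.strongInduction generalizing y with
  | _ Y ih =>
    obtain ⟨m, hm, hmm⟩ : ∃ m ∈ Y, ∀ a ∈ Y, a ≤ m :=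
      ⟨Y.max' ⟨z, hz⟩, Y.max'_mem _, fun a ha => Y.le_max' a ha⟩
    have hmy := hmax m hm
    have hcard := Finset.card_erase_add_one hm
    rw [← hcard, add_mul, one_mul]
    by_cases hzm : z = m
    · have : Y.erase m = ∅ := by
        ext a
        simp only [Finset.mem_erase, Finset.notMem_empty, iff_false, not_and]
        intro h1 h2
        exact h1 (le_antisymm (hmm a h2) (hzm ▸ hmin a h2))
      simp only [this, Finset.card_empty]
      omega
    · have hzm' : z < m := lt_of_le_of_ne (hmin m hm) hzm
      have hv := hsep z hz m hm hzm'
      have := ih (Y.erase m) (Finset.erase_ssubset hm) (y := m - v)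
        (Finset.mem_erase.2 ⟨hzm, hz⟩)
        (fun a ha => hmin a (Finset.mem_of_mem_erase ha))
        (fun a ha => by
          have ha' := Finset.mem_erase.1 ha
          have := hsep a ha'.2 m hm (lt_of_le_of_ne (hmm a ha'.2) ha'.1)
          omega)
        (fun a ha b hb => hsep a (Finset.mem_of_mem_erase ha) b (Finset.mem_of_mem_erase hb))
      omega

theorem phase_spread {q : ℕ} {u : ℕ → α} {w : ℤ → α} {Y : Finset ℕ} {v z y : ℕ}
    (hY : ∀ x ∈ Y, Anchored q u w x ∧ leastPeriod u x = v) (hz : z ∈ Y)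
    (hmin : ∀ a ∈ Y, z ≤ a) (hmax : ∀ a ∈ Y, a ≤ y) : z + Y.card * v ≤ y + v :=
  separated_card_le hz hmin hmax fun a ha b hb hab =>
    (hY a ha).2 ▸ (hY a ha).1.add_leastPeriod_le (hY b hb).1 hab

theorem phase_card_le {q : ℕ} (hq : 1 ≤ q) {u : ℕ → α} {w : ℤ → α} {Y : Finset ℕ} {v : ℕ}
    (hY : ∀ x ∈ Y, Anchored q u w x ∧ leastPeriod u x = v) : Y.card ≤ q := by
  by_contra! hcard
  have hne : Y.Nonempty := Finset.card_pos.1 (by omega)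
  set m := Y.max' hne
  have hm : m ∈ Y := Y.max'_mem hne
  have hc := Finset.card_erase_of_mem hm
  have hne' : (Y.erase m).Nonempty := Finset.card_pos.1 (by omega)
  set y := (Y.erase m).max' hne'
  have hy : y ∈ Y.erase m := (Y.erase m).max'_mem hne'
  have hyY := Finset.mem_of_mem_erase hy
  set z := (Y.erase m).min' hne'
  have hz : z ∈ Y.erase m := (Y.erase m).min'_mem hne'
  have hspread := phase_spread (y := y) (fun x hx => hY x (Finset.mem_of_mem_erase hx)) hz
    (fun a ha => Finset.min'_le _ a ha) (fun a ha => Finset.le_max' _ a ha)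
  have hvz : v ≤ z := (hY z (Finset.mem_of_mem_erase hz)).2 ▸
    leastPeriod_le_self u (hY z (Finset.mem_of_mem_erase hz)).1.1
  have hvy : v ≤ y := (hY y hyY).2 ▸ leastPeriod_le_self u (hY y hyY).1.1
  have hym : y < m :=
    lt_of_le_of_ne (Y.le_max' y hyY) (Finset.ne_of_mem_erase hy)
  obtain ⟨c, hyc, hcq, hgap⟩ := (hY y hyY).1.gap (hY m hm).1 hym
  have hpm := (hY m hm).2
  have hvc : v ≤ leastPeriod u c := (hY y hyY).2 ▸ leastPeriod_mono u hyc
  rcases hvc.eq_or_lt with h | h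
  · rw [← h] at hcq
    have : q * v ≤ (Y.erase m).card * v := Nat.mul_le_mul_right v (by omega)
    omega
  · have := lt_leastPeriod_add (u := u) (s := m) (t := c) (by omega)
    omega

theorem pow_card_filter_le {q : ℕ} (hq : 1 ≤ q) {u : ℕ → α} {w : ℤ → α} {X : Finset ℕ}
    (hX : ∀ x ∈ X, Anchored q u w x) {x : ℕ} (hx : x ∈ X) :
    q ^ (X.filter fun a => leastPeriod u a < leastPeriod u x).card ≤
      (x ^ 2 * leastPeriod u x) ^ q := by
  induction x using Nat.strong_induction_on with
  | _ x ih =>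
    rcases (X.filter fun a => leastPeriod u a < leastPeriod u x).eq_empty_or_nonempty with h | hne
    · rw [h, Finset.card_empty, pow_zero]
      exact Nat.one_le_pow _ _ (Nat.mul_pos (Nat.pow_pos (hX x hx).1) (leastPeriod_pos u x))
    set Z := X.filter fun a => leastPeriod u a < leastPeriod u x
    set y := Z.max' hne
    have hy : y ∈ Z := Z.max'_mem hne
    have hyX := (Finset.mem_filter.1 hy).1
    have hyp := (Finset.mem_filter.1 hy).2
    set v := leastPeriod u y
    set Y := X.filter fun a => leastPeriod u a = v
    have hYmem : ∀ a ∈ Y, a ∈ X ∧ leastPeriod u a = v := fun a ha => Finset.mem_filter.1 ha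
    have hYX : ∀ a ∈ Y, Anchored q u w a ∧ leastPeriod u a = v := fun a ha =>
      ⟨hX a (hYmem a ha).1, (hYmem a ha).2⟩
    have hyY : y ∈ Y := Finset.mem_filter.2 ⟨hyX, rfl⟩
    have hYne : Y.Nonempty := ⟨y, hyY⟩
    set z := Y.min' hYne
    have hz : z ∈ Y := Y.min'_mem hYne
    have hzv : leastPeriod u z = v := (hYmem z hz).2
    have hYy : ∀ a ∈ Y, a ≤ y := fun a ha => Z.le_max' a
      (Finset.mem_filter.2 ⟨(hYmem a ha).1, (hYmem a ha).2 ▸ hyp⟩)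
    have hspread := phase_spread hYX hz (fun a ha => Y.min'_le a ha) hYy
    have hcard := phase_card_le hq hYX
    have hcard1 : 1 ≤ Y.card := Finset.card_pos.2 hYne
    have hyx : y < x := by
      by_contra! h
      exact absurd (leastPeriod_mono u h) (by omega)
    have hzx : z < x := (hYy z hz).trans_lt hyx
    have hgap := (hX y hyX).add_leastPeriod_le (hX x hx) hyx
    have hjump := lt_leastPeriod_add hyp
    have hvz : v ≤ z := hzv ▸ leastPeriod_le_self u (hYX z hz).1.1
    have hsplit : Z.card = (X.filter fun a => leastPeriod u a < leastPeriod u z).card + Y.card := by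
      rw [hzv, ← Finset.card_union_of_disjoint]
      · congr 1
        ext a
        simp only [Z, Y, Finset.mem_filter, Finset.mem_union, ← and_or_left, ← le_iff_lt_or_eq]
        refine and_congr_right fun ha => ⟨fun h => ?_, fun h => h.trans_lt hyp⟩
        exact leastPeriod_mono u (Z.le_max' a (Finset.mem_filter.2 ⟨ha, h⟩))
      · refine Finset.disjoint_left.2 fun a ha hb => ?_
        have h1 := (Finset.mem_filter.1 ha).2
        have h2 := (Finset.mem_filter.1 hb).2
        omega
    rw [hsplit, pow_add]
    calc _ ≤ (z ^ 2 * leastPeriod u z) ^ q * (1 + Y.card) ^ q :=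
          Nat.mul_le_mul (ih z hzx (hYmem z hz).1) (Nat.pow_le_one_add_pow hcard1 hcard)
      _ = (z ^ 2 * v * (1 + Y.card)) ^ q := by rw [hzv, mul_pow _ (1 + Y.card)]
      _ ≤ _ := Nat.pow_le_pow_left
          (potential_growth hcard1 hvz (by omega) hyp (by omega)) q

theorem anchored_card_le {q : ℕ} (hq : 2 ≤ q) {u : ℕ → α} {w : ℤ → α} {X : Finset ℕ} {L : ℕ}
    (hX : ∀ x ∈ X, Anchored q u w x) (hL : ∀ x ∈ X, x ≤ q ^ L) :
    X.card ≤ 3 * q * L + q := by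
  rcases X.eq_empty_or_nonempty with rfl | hne
  · simp
  set m := X.max' hne
  have hm : m ∈ X := X.max'_mem hne
  have hle : ∀ a ∈ X, leastPeriod u a ≤ leastPeriod u m := fun a ha =>
    leastPeriod_mono u (X.le_max' a ha)
  have hlast : (X.filter fun a => ¬ leastPeriod u a < leastPeriod u m).card ≤ q :=
    phase_card_le (u := u) (w := w) (v := leastPeriod u m) (by omega) fun a ha => by
      obtain ⟨h1, h2⟩ := Finset.mem_filter.1 ha
      exact ⟨hX a h1, le_antisymm (hle a h1) (not_lt.1 h2)⟩
  have hpow := pow_card_filter_le (by omega) hX hm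
  have hbound : (m ^ 2 * leastPeriod u m) ^ q ≤ q ^ (3 * q * L) := by
    calc _ ≤ ((q ^ L) ^ 2 * q ^ L) ^ q := Nat.pow_le_pow_left (Nat.mul_le_mul
          (Nat.pow_le_pow_left (hL m hm) 2)
          ((leastPeriod_le_self u (hX m hm).1).trans (hL m hm))) q
      _ = q ^ (3 * q * L) := by ring
  have := (Nat.pow_le_pow_iff_right (by omega)).1 (hpow.trans hbound)
  rw [← Finset.card_filter_add_card_filter_not (s := X)
    (fun a => leastPeriod u a < leastPeriod u m)]
  omega

theorem isPeriodOf_substr {dollar : α} {S : List α} {d i j : ℕ} :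
    IsPeriodOf d (substr dollar S i j) ↔
      1 ≤ d ∧ ∀ k, k + d < j + 1 - i → chr dollar S (i + k) = chr dollar S (i + (k + d)) := by
  simp [IsPeriodOf, substr]

theorem minPeriod_substr_right (dollar : α) (S : List α) {i b : ℕ} (hi : 1 ≤ i) :
    minPeriod (substr dollar S i (i + b - 1)) =
      leastPeriod (fun k => chr dollar S (i + k)) b := by
  have : i + b - 1 + 1 - i = b := by omega
  simp only [minPeriod, leastPeriod, isPeriodOf_substr, PrefixPeriod, this]

theorem minPeriod_substr_left (dollar : α) (S : List α) {i a : ℕ} (hi : a < i) :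
    minPeriod (substr dollar S (i - a) (i - 1)) =
      leastPeriod (fun k => chr dollar S (i - 1 - k)) a := by
  have : i - 1 + 1 - (i - a) = a := by omega
  simp only [minPeriod, leastPeriod, isPeriodOf_substr, PrefixPeriod, this]
  congr 1
  ext d
  refine and_congr_right fun hd => ⟨fun h k hk => ?_, fun h k hk => ?_⟩
  · have := h (a - 1 - (k + d)) (by omega)
    rw [show i - a + (a - 1 - (k + d) + d) = i - 1 - k by omega,
      show i - a + (a - 1 - (k + d)) = i - 1 - (k + d) by omega] at this
    exact this.symm
  · have := h (a - 1 - (k + d)) (by omega)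
    rw [show i - 1 - (a - 1 - (k + d) + d) = i - a + k by omega,
      show i - 1 - (a - 1 - (k + d)) = i - a + (k + d) by omega] at this
    exact this.symm

theorem length_substr (dollar : α) (S : List α) (i j : ℕ) :
    (substr dollar S i j).length = j + 1 - i := by
  simp [substr]

/-- A maximal pair crossing `i` is determined by the position aligned with `i`. -/
theorem IsMaximalPair.eq_of_aligned {dollar : α} {S : List α} {i n m l n' m' l' : ℕ}
    (h : IsMaximalPair dollar S n m l) (h' : IsMaximalPair dollar S n' m' l')
    (hi : n ≤ i ∧ i ≤ n + l) (hi' : n' ≤ i ∧ i ≤ n' + l')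
    (he : m + (i - n) = m' + (i - n')) : n = n' ∧ m = m' ∧ l = l' := by
  obtain ⟨_, _, _, _, _, heq, hleft, hright⟩ := h
  obtain ⟨_, _, _, _, _, heq', hleft', hright'⟩ := h'
  have hn : n = n' := by
    rcases lt_trichotomy n n' with hlt | rfl | hlt
    · refine absurd (heq (n' - 1 - n) (by omega)) ?_
      rwa [show n + (n' - 1 - n) = n' - 1 by omega, show m + (n' - 1 - n) = m' - 1 by omega]
    · rfl
    · refine absurd (heq' (n - 1 - n') (by omega)) ?_
      rwa [show n' + (n - 1 - n') = n - 1 by omega, show m' + (n - 1 - n') = m - 1 by omega]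
  subst hn
  obtain rfl : m = m' := by omega
  refine ⟨rfl, rfl, ?_⟩
  rcases lt_trichotomy l l' with hlt | rfl | hlt
  · exact absurd (heq' l hlt) hright
  · rfl
  · exact absurd (heq l' hlt) hright'

theorem IsMaximalPair.anchored_right {dollar : α} {S : List α} {q i j n m l : ℕ}
    (h : IsMaximalPair dollar S n m l)
    (hpow : ¬ IsFracPowGe q (substr dollar S i (n + l - 1)))
    (hi : n ≤ i ∧ i ≤ n + l) (hj : j ≤ m + l) (hlt : m + (i - n) < j) :
    Anchored q (fun k => chr dollar S (i + k)) (fun z => chr dollar S (j + z).toNat)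
      (j - (m + (i - n))) := by
  obtain ⟨_, _, _, _, _, heq, -, -⟩ := h
  refine ⟨by omega, n + l - i, by omega, ?_, fun k hk => ?_⟩
  · rw [IsFracPowGe, length_substr, show n + l - 1 = i + (n + l - i) - 1 by omega,
      minPeriod_substr_right _ _ (by omega)] at hpow
    omega
  · have := heq (i - n + k) (by omega)
    rw [show n + (i - n + k) = i + k by omega] at this
    simp only [this]
    congr 1
    omega

theorem IsMaximalPair.anchored_left {dollar : α} {S : List α} {q i j n m l : ℕ}
    (h : IsMaximalPair dollar S n m l)
    (hpow : ¬ IsFracPowGe q (substr dollar S n (i - 1)))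
    (hi : n ≤ i ∧ i ≤ n + l) (hj : m ≤ j) (hlt : j < m + (i - n)) :
    Anchored q (fun k => chr dollar S (i - 1 - k)) (fun z => chr dollar S (j - 1 - z).toNat)
      (m + (i - n) - j) := by
  obtain ⟨_, _, _, _, _, heq, -, -⟩ := h
  refine ⟨by omega, i - n, by omega, ?_, fun k hk => ?_⟩
  · rw [IsFracPowGe, length_substr, show n = i - (i - n) by omega,
      minPeriod_substr_left _ _ (by omega)] at hpow
    omega
  · have := heq (i - 1 - k - n) (by omega)
    rw [show n + (i - 1 - k - n) = i - 1 - k by omega] at this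
    simp only [this]
    congr 1
    omega

/-- For indices `i`, `j` of characters in `S$` there are at most
`18·q·⌈log_q(|S$|)⌉` maximal pairs whose first occurrence crosses `i` without a `q`-th-power
part on either side of `i`, and whose second occurrence crosses `j`. -/
theorem maximal_pairs_two_indices (dollar : α) (S : List α)
    (hdollar : dollar ∉ S)
    (q : ℕ) (hq : 2 ≤ q)
    (i j : ℕ) (hi : 1 ≤ i ∧ i ≤ S.length + 1) (hj : 1 ≤ j ∧ j ≤ S.length + 1)
    (M : Finset (ℕ × ℕ × ℕ))
    (hM : ∀ p ∈ M, IsMaximalPair dollar S p.1 p.2.1 p.2.2 ∧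
      ¬ IsFracPowGe q (substr dollar S p.1 (i - 1)) ∧
      ¬ IsFracPowGe q (substr dollar S i (p.1 + p.2.2 - 1)) ∧
      (p.1 ≤ i ∧ i ≤ p.1 + p.2.2) ∧
      (p.2.1 ≤ j ∧ j ≤ p.2.1 + p.2.2)) :
    (M.card : ℝ) ≤ 18 * (q : ℝ) * (⌈Real.logb (q : ℝ) ((S.length : ℝ) + 1)⌉ : ℝ) := by
  classical
  rcases M.eq_empty_or_nonempty with rfl | ⟨p₀, hp₀⟩
  · have : 0 ≤ ⌈Real.logb (q : ℝ) ((S.length : ℝ) + 1)⌉ :=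
      Int.ceil_nonneg (Real.logb_nonneg (by exact_mod_cast (by omega : 1 < q)) (by simp))
    have : (0 : ℝ) ≤ (⌈Real.logb (q : ℝ) ((S.length : ℝ) + 1)⌉ : ℝ) := by exact_mod_cast this
    rw [Finset.card_empty, Nat.cast_zero]
    positivity
  obtain ⟨L, hL⟩ : ∃ L : ℕ, (L : ℤ) = ⌈Real.logb (q : ℝ) ((S.length : ℝ) + 1)⌉ :=
    Int.eq_ofNat_of_zero_le (Int.ceil_nonneg
      (Real.logb_nonneg (by exact_mod_cast (by omega : 1 < q)) (by simp))) |>.imp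
      fun _ h => h.symm
  have hSL : S.length + 1 ≤ q ^ L := by
    have h1 : Real.logb (q : ℝ) ((S.length : ℝ) + 1) ≤ (L : ℝ) := by
      have := Int.le_ceil (Real.logb (q : ℝ) ((S.length : ℝ) + 1))
      rw [← hL] at this
      exact_mod_cast this
    rw [Real.logb_le_iff_le_rpow (by exact_mod_cast (by omega : 1 < q)) (by positivity),
      Real.rpow_natCast] at h1
    exact_mod_cast h1
  have hL1 : 1 ≤ L := by
    obtain ⟨h1, h2, _, h3, _⟩ := (hM p₀ hp₀).1
    by_contra! h
    obtain rfl : L = 0 := by omega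
    rw [pow_zero] at hSL
    omega
  set e : ℕ × ℕ × ℕ → ℕ := fun p => p.2.1 + (i - p.1)
  have he : Set.InjOn e M := fun p hp p' hp' h => by
    obtain ⟨h1, -, -, h2, -⟩ := hM p hp
    obtain ⟨h1', -, -, h2', -⟩ := hM p' hp'
    obtain ⟨ha, hb, hc⟩ := h1.eq_of_aligned h1' h2 h2' h
    exact Prod.ext ha (Prod.ext hb hc)
  set E := M.image e
  have hE : E.card = M.card := Finset.card_image_of_injOn he
  set R := (E.filter (· < j)).image (j - ·)
  have hR : R.card = (E.filter (· < j)).card := Finset.card_image_of_injOn fun x hx y hy h => by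
    have hx' := (Finset.mem_filter.1 hx).2
    have hy' := (Finset.mem_filter.1 hy).2
    omega
  set T := (E.filter (j < ·)).image (· - j)
  have hT : T.card = (E.filter (j < ·)).card := Finset.card_image_of_injOn fun x hx y hy h => by
    have hx' := (Finset.mem_filter.1 hx).2
    have hy' := (Finset.mem_filter.1 hy).2
    omega
  have hRcard : R.card ≤ 3 * q * L + q := by
    refine anchored_card_le hq (u := fun k => chr dollar S (i + k))
      (w := fun z => chr dollar S (j + z).toNat) ?_ ?_ <;>
    · intro x hx
      obtain ⟨y, hy, rfl⟩ := Finset.mem_image.1 hx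
      obtain ⟨hyE, hyj⟩ := Finset.mem_filter.1 hy
      obtain ⟨p, hp, rfl⟩ := Finset.mem_image.1 hyE
      obtain ⟨h1, -, h2, h3, h4⟩ := hM p hp
      first
      | exact h1.anchored_right h2 h3 h4.2 hyj
      | obtain ⟨_, _, _, _, _, -⟩ := h1
        simp only [e] at hyj ⊢
        omega
  have hTcard : T.card ≤ 3 * q * L + q := by
    refine anchored_card_le hq (u := fun k => chr dollar S (i - 1 - k))
      (w := fun z => chr dollar S (j - 1 - z).toNat) ?_ ?_ <;>
    · intro x hx
      obtain ⟨y, hy, rfl⟩ := Finset.mem_image.1 hx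
      obtain ⟨hyE, hyj⟩ := Finset.mem_filter.1 hy
      obtain ⟨p, hp, rfl⟩ := Finset.mem_image.1 hyE
      obtain ⟨h1, h2, -, h3, h4⟩ := hM p hp
      first
      | exact h1.anchored_left h2 h3 h4.1 hyj
      | obtain ⟨_, _, _, _, _, -⟩ := h1
        simp only [e] at hyj ⊢
        omega
  have hcover : E ⊆ (E.filter (· < j) ∪ E.filter (j < ·)) ∪ {j} := fun x hx => by
    simp only [Finset.mem_union, Finset.mem_filter, Finset.mem_singleton]
    rcases lt_trichotomy x j with h | h | h <;> tauto
  have hcard : M.card ≤ 18 * q * L := by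
    have h1 := Finset.card_le_card hcover
    have h2 := Finset.card_union_le (E.filter (· < j) ∪ E.filter (j < ·)) {j}
    have h3 := Finset.card_union_le (E.filter (· < j)) (E.filter (j < ·))
    rw [Finset.card_singleton] at h2
    have h4 : q ≤ q * L := Nat.le_mul_of_pos_right q hL1
    have h5 : 3 * q * L = 3 * (q * L) := by ring
    have h6 : 18 * q * L = 18 * (q * L) := by ring
    omega
  have hLr : (⌈Real.logb (q : ℝ) ((S.length : ℝ) + 1)⌉ : ℝ) = (L : ℝ) := by
    rw [← hL, Int.cast_natCast]
  rw [hLr]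
  exact_mod_cast hcard
end

section
/- Let S be a string and let P₁, P₂ be two substrings of S such that: either both P₁ and P₂ are prefixes of S or both are suffixes of S; the lengths satisfy |P₁| ≤ |P₂| ≤ 2|P₁|; and both P₁ and P₂ are fractional powers with exponent ≥ 3. Then P₁ and P₂ have the same minimal period length. -/
variable {α : Type*}

theorem isPeriodOf_iff_getElem? {Δ : ℕ} {T : List α} :
    IsPeriodOf Δ T ↔ 1 ≤ Δ ∧ ∀ k, k + Δ < T.length → T[k]? = T[k + Δ]? := by
  refine and_congr_right fun _ => forall₂_congr fun k h => ?_
  rw [List.getElem?_eq_getElem h, List.getElem?_eq_getElem (by omega : k < T.length)]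
  simp

theorem IsPeriodOf.reverse {Δ : ℕ} {T : List α} (h : IsPeriodOf Δ T) :
    IsPeriodOf Δ T.reverse := by
  rw [isPeriodOf_iff_getElem?] at h ⊢
  refine ⟨h.1, fun k hk => ?_⟩
  rw [List.length_reverse] at hk
  rw [List.getElem?_reverse (by omega), List.getElem?_reverse hk,
    h.2 (T.length - 1 - (k + Δ)) (by omega)]
  congr 1
  omega

theorem minPeriod_reverse (T : List α) : minPeriod T.reverse = minPeriod T := by
  have h : {Δ | IsPeriodOf Δ T.reverse} = {Δ | IsPeriodOf Δ T} :=
    Set.ext fun Δ => ⟨fun h => by simpa using IsPeriodOf.reverse h, IsPeriodOf.reverse⟩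
  rw [minPeriod, minPeriod, h]

theorem isPeriodOf_minPeriod (T : List α) : IsPeriodOf (minPeriod T) T :=
  Nat.sInf_mem (s := {Δ | IsPeriodOf Δ T}) ⟨T.length + 1, by omega, fun k h => by omega⟩

theorem IsPeriodOf.minPeriod_le {Δ : ℕ} {T : List α} (h : IsPeriodOf Δ T) : minPeriod T ≤ Δ :=
  Nat.sInf_le h

theorem getElem?_eq_of_prefix {P T : List α} (h : P <+: T) {k : ℕ} (hk : k < P.length) :
    P[k]? = T[k]? := by
  obtain ⟨t, rfl⟩ := h
  rw [List.getElem?_append_left hk]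

theorem IsPeriodOf.of_prefix {Δ : ℕ} {P T : List α} (hPT : P <+: T) (h : IsPeriodOf Δ T) :
    IsPeriodOf Δ P := by
  rw [isPeriodOf_iff_getElem?] at h ⊢
  have hle := hPT.length_le
  refine ⟨h.1, fun k hk => ?_⟩
  rw [getElem?_eq_of_prefix hPT hk, getElem?_eq_of_prefix hPT (by omega), h.2 k (by omega)]

/-- A period of a prefix extends to the whole word if the word has a second period and the
prefix is at least as long as the sum of the two periods. -/
theorem IsPeriodOf.extend_of_prefix {p q : ℕ} {P T : List α} (hPT : P <+: T)
    (hp : IsPeriodOf p P) (hq : IsPeriodOf q T) (hpq : p + q ≤ P.length) : IsPeriodOf p T := by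
  rw [isPeriodOf_iff_getElem?] at hp hq ⊢
  refine ⟨hp.1, fun k => ?_⟩
  induction k using Nat.strong_induction_on with
  | _ k ih =>
    intro hk
    have hq1 := hq.1
    rcases lt_or_ge k q with hkq | hkq
    · rw [← getElem?_eq_of_prefix hPT (by omega : k < P.length),
        ← getElem?_eq_of_prefix hPT (by omega : k + p < P.length)]
      exact hp.2 k (by omega)
    · have e₁ := hq.2 (k - q) (by omega)
      have e₂ := hq.2 (k - q + p) (by omega)
      rw [show k - q + q = k by omega] at e₁
      rw [show k - q + p + q = k + p by omega] at e₂
      rw [← e₁, ← e₂]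
      exact ih (k - q) (by omega) (by omega)

theorem minPeriod_eq_of_prefix {P T : List α} (hPT : P <+: T)
    (h : minPeriod P + minPeriod T ≤ P.length) : minPeriod P = minPeriod T :=
  le_antisymm ((isPeriodOf_minPeriod T).of_prefix hPT).minPeriod_le
    ((isPeriodOf_minPeriod P).extend_of_prefix hPT (isPeriodOf_minPeriod T) h).minPeriod_le

/-- Lemma `twoCubes`. Two prefixes (or two suffixes) of `S` which are both
at least cubes and whose lengths differ by at most a factor of two have the same minimal
period length. -/
theorem two_cubes_same_min_period (S P₁ P₂ : List α)
    (hps : (P₁ <+: S ∧ P₂ <+: S) ∨ (P₁ <:+ S ∧ P₂ <:+ S))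
    (hlen₁ : P₁.length ≤ P₂.length) (hlen₂ : P₂.length ≤ 2 * P₁.length)
    (h₁ : IsFracPowGe 3 P₁) (h₂ : IsFracPowGe 3 P₂) :
    minPeriod P₁ = minPeriod P₂ := by
  unfold IsFracPowGe at h₁ h₂
  rcases hps with ⟨hP₁, hP₂⟩ | ⟨hP₁, hP₂⟩
  · exact minPeriod_eq_of_prefix (List.prefix_of_prefix_length_le hP₁ hP₂ hlen₁) (by omega)
  · rw [← minPeriod_reverse P₁, ← minPeriod_reverse P₂]
    refine minPeriod_eq_of_prefix
      (List.reverse_prefix.mpr (List.suffix_of_suffix_length_le hP₁ hP₂ hlen₁)) ?_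
    rw [minPeriod_reverse, minPeriod_reverse, List.length_reverse]
    omega
end
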